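/- For every prime p there exist positive integers n and c_0, …, c_{2p−1} with the following property. Let A be the Lie algebra over ℤ with generators x_0, …, x_{2p−1} and y_{i,1}, …, y_{i,1+c_i} for i = 0, …, 2p−1, writing y_i := ⁅y_{i,1}, …, y_{i,1+c_i}⁆ for the left-normed iterated bracket, subject to the relations x_0 + ⋯ + x_{2p−1} = 0 and p^{c_i}·x_i = y_i for i = 0, …, 2p−1 (i.e. A is the quotient of the free Lie ℤ-algebra on all listed generators by the Lie ideal generated by these relation elements). Then there is an element a ∈ A with a ∈ δ_n(A), a ∉ γ_n(A) and p·a ∈ γ_n(A), so δ_n(A)/γ_n(A) contains an element of order p. -/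

import Mathlib

/-- The augmentation ideal of the universal enveloping algebra `U(A)` of a Lie ring `A`:
the two-sided ideal generated by the image of `A`, viewed as a `ℤ`-submodule. -/
noncomputable def augIdealLie (A : Type*) [LieRing A] [LieAlgebra ℤ A] :
    Submodule ℤ (UniversalEnvelopingAlgebra ℤ A) :=
  Submodule.span ℤ
    {x | ∃ (l r : UniversalEnvelopingAlgebra ℤ A) (m : A),
      x = l * (UniversalEnvelopingAlgebra.ι ℤ m) * r}

/-- The `n`-th dimension subring `δ_n(A) = {a ∈ A : ι(a) ∈ ϖ^n}`. -/
noncomputable def dimensionSubring (A : Type*) [LieRing A] [LieAlgebra ℤ A] (n : ℕ) : Set A :=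
  {a : A | (UniversalEnvelopingAlgebra.ι ℤ a) ∈ (augIdealLie A) ^ n}

/-- `γ_n(A)`, the `n`-th term of the lower central series of Lie ideals, with `γ_1(A) = A`. -/
def gammaLie (A : Type*) [LieRing A] [LieAlgebra ℤ A] (n : ℕ) : LieSubmodule ℤ A A :=
  LieModule.lowerCentralSeries ℤ A A (n - 1)

/-- Left-normed iterated Lie bracket `⁅a₁, a₂, …, a_d⁆` of a list of elements. -/
def leftBracket {L : Type*} [LieRing L] : List L → L
  | [] => 0
  | a :: l => l.foldl (fun x y => ⁅x, y⁆) a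

/-- The generating set: `x_0, …, x_{2p-1}` and `y_{i,1}, …, y_{i,1+cᵢ}` for each `i`. -/
abbrev LieGen (p : ℕ) (c : Fin (2 * p) → ℕ) : Type :=
  Fin (2 * p) ⊕ ((i : Fin (2 * p)) × Fin (1 + c i))

/-- The generator `x_i` of the free Lie `ℤ`-algebra. -/
noncomputable def xLie (p : ℕ) (c : Fin (2 * p) → ℕ) (i : Fin (2 * p)) : FreeLieAlgebra ℤ (LieGen p c) :=
  FreeLieAlgebra.of ℤ (Sum.inl i)

/-- `y_i`, the left-normed bracket `⁅y_{i,1}, …, y_{i,1+cᵢ}⁆` in the free Lie algebra. -/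
noncomputable def yLie (p : ℕ) (c : Fin (2 * p) → ℕ) (i : Fin (2 * p)) : FreeLieAlgebra ℤ (LieGen p c) :=
  leftBracket (List.ofFn fun j : Fin (1 + c i) => FreeLieAlgebra.of ℤ (Sum.inr ⟨i, j⟩))

/-- The relation elements: `x_0 + ⋯ + x_{2p-1}` and `p^{cᵢ}·x_i - y_i` for all `i`. -/
noncomputable def lieRels (p : ℕ) (c : Fin (2 * p) → ℕ) : Set (FreeLieAlgebra ℤ (LieGen p c)) :=
  insert (∑ i : Fin (2 * p), xLie p c i)
    {v | ∃ i : Fin (2 * p), v = (p ^ (c i) : ℤ) • xLie p c i - yLie p c i}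

/-- The Lie algebra of the Main Theorem: the quotient of the free Lie `ℤ`-algebra
on the listed generators by the Lie ideal generated by the relation elements. -/
abbrev MainLie (p : ℕ) (c : Fin (2 * p) → ℕ) : Type :=
  FreeLieAlgebra ℤ (LieGen p c) ⧸
    LieSubmodule.lieSpan ℤ (FreeLieAlgebra ℤ (LieGen p c)) (lieRels p c)



section PolyPart
open Finset

/-- The bilinear divided difference polynomial. -/
def Dpoly {K : Type*} [CommRing K] (A B C : K) (m i : ℕ) : K :=
  (∑ a ∈ range i, A ^ a * B ^ (i - 1 - a)) * C ^ (m - i) -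
    A ^ i * ∑ b ∈ range (m - i), B ^ b * C ^ (m - i - 1 - b)

lemma Dpoly_mul {K : Type*} [CommRing K] (A B C : K) (m i : ℕ) :
    Dpoly A B C m i * ((A - B) * (B - C)) =
      (A - C) * (A ^ i * C ^ (m - i)) - (B - C) * (B ^ i * C ^ (m - i)) -
        (A - B) * (A ^ i * B ^ (m - i)) := by
  unfold Dpoly
  have h1 := (Commute.all A B).geom_sum₂_mul i
  have h2 := (Commute.all B C).geom_sum₂_mul (m - i)
  linear_combination (C ^ (m - i) * (B - C)) * h1 - (A ^ i * (A - B)) * h2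

lemma sum_Dpoly_mul {K : Type*} [CommRing K] (A B C : K) (m : ℕ) :
    (∑ i ∈ range (m + 1), Dpoly A B C m i) * ((A - B) * (B - C)) = 0 := by
  rw [sum_mul]
  rw [sum_congr rfl (fun i hi => Dpoly_mul A B C m i)]
  rw [sum_sub_distrib, sum_sub_distrib, ← mul_sum, ← mul_sum, ← mul_sum]
  have h1 := (Commute.all A C).geom_sum₂_mul (m + 1)
  have h2 := (Commute.all B C).geom_sum₂_mul (m + 1)
  have h3 := (Commute.all A B).geom_sum₂_mul (m + 1)
  simp only [Nat.add_sub_cancel] at h1 h2 h3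
  linear_combination h1 - h2 - h3

lemma binom_neg {K : Type*} [CommRing K] (A C : K) (m : ℕ) :
    ∑ i ∈ range (m + 1), ((-1 : K) ^ i * (m.choose i : K)) * (A ^ i * C ^ (m - i)) =
      (-1) ^ m * (A - C) ^ m := by
  rw [← mul_pow, show (-1) * (A - C) = (-A) + C by ring, add_pow]
  refine sum_congr rfl fun i _ => ?_
  rw [neg_pow A]; ring

lemma sum_fDpoly_mul {K : Type*} [CommRing K] (A B C : K) (m : ℕ) :
    (∑ i ∈ range (m + 1), ((-1 : K) ^ i * (m.choose i : K)) * Dpoly A B C m i) *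
      ((A - B) * (B - C)) =
      (-1) ^ m * ((A - C) ^ (m + 1) - (B - C) ^ (m + 1) - (A - B) ^ (m + 1)) := by
  rw [sum_mul]
  have h : ∀ i ∈ range (m + 1), ((-1 : K) ^ i * (m.choose i : K)) * Dpoly A B C m i *
      ((A - B) * (B - C)) = (A - C) * (((-1 : K) ^ i * (m.choose i : K)) * (A ^ i * C ^ (m - i)))
      - (B - C) * (((-1 : K) ^ i * (m.choose i : K)) * (B ^ i * C ^ (m - i)))
      - (A - B) * (((-1 : K) ^ i * (m.choose i : K)) * (A ^ i * B ^ (m - i))) := by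
    intro i hi
    have := Dpoly_mul A B C m i
    linear_combination ((-1 : K) ^ i * (m.choose i : K)) * this
  rw [sum_congr rfl h, sum_sub_distrib, sum_sub_distrib, ← mul_sum, ← mul_sum, ← mul_sum,
    binom_neg, binom_neg, binom_neg]
  ring

lemma binom_mid {K : Type*} [CommRing K] (u w : K) (p : ℕ) (hp : p.Prime) :
    (p : K) * (∑ l ∈ range (p - 1), ((p.choose (l + 1) / p : ℕ) : K) * (u ^ l * w ^ (p - 2 - l)))
      * (u * w) = (u + w) ^ p - w ^ p - u ^ p := by
  obtain ⟨k, rfl⟩ : ∃ k, p = k + 2 := ⟨p - 2, by have := hp.two_le; omega⟩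
  rw [add_pow, sum_range_succ, sum_range_succ']
  simp only [mul_sum, sum_mul, Nat.choose_zero_right, Nat.choose_self]
  have : ∀ l ∈ range (k + 2 - 1), ((k + 2 : ℕ) : K) * ((((k+2).choose (l + 1) / (k+2) : ℕ) : K) *
      (u ^ l * w ^ (k + 2 - 2 - l))) * (u * w) =
      u ^ (l + 1) * w ^ (k + 2 - (l + 1)) * ((k+2).choose (l + 1) : K) := by
    intro l hl
    have hl' : l < k + 1 := by simpa using hl
    have hd : (k + 2) ∣ (k + 2).choose (l + 1) :=
      hp.dvd_choose_self (by omega) (by omega)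
    have hc : ((k+2).choose (l + 1) : K) =
        ((k + 2 : ℕ) : K) * ((((k+2).choose (l + 1) / (k+2) : ℕ) : K)) := by
      rw [← Nat.cast_mul, Nat.mul_div_cancel' hd]
    rw [hc, show k + 2 - (l + 1) = (k + 2 - 2 - l) + 1 by omega]
    ring
  rw [sum_congr rfl this]
  simp only [show k + 2 - 1 = k + 1 by omega]
  simp
  ring

lemma exists_g (p : ℕ) (hp : p.Prime) : ∃ g : ℕ → ℤ,
    (∀ i ∈ range p, (-1 : ℤ) ^ i * ((p - 1).choose i : ℤ) = 1 + p * g i) ∧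
      ∑ i ∈ range p, g i = -1 := by
  have key : ∀ i, i < p → (p : ℤ) ∣ (-1 : ℤ) ^ i * ((p - 1).choose i : ℤ) - 1 := by
    intro i
    induction i with
    | zero => intro _; simp
    | succ i ih =>
      intro hi
      have h1 := ih (by omega)
      have h2 : (p : ℤ) ∣ (p.choose (i + 1) : ℤ) := by
        exact_mod_cast hp.dvd_choose_self (by omega) hi
      have h3 : p.choose (i + 1) = (p - 1).choose i + (p - 1).choose (i + 1) := by
        conv_lhs => rw [show p = (p - 1) + 1 by have := hp.two_le; omega]
        rw [Nat.choose_succ_succ]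
      have h4 : (-1 : ℤ) ^ (i + 1) * ((p - 1).choose (i + 1) : ℤ) - 1 =
        ((-1 : ℤ) ^ i * ((p - 1).choose i : ℤ) - 1) - (-1) ^ i * (p.choose (i + 1) : ℤ) := by
        rw [h3]; push_cast; ring
      rw [h4]
      exact dvd_sub h1 (Dvd.dvd.mul_left h2 _)
  choose! g hg using key
  refine ⟨g, fun i hi => ?_, ?_⟩
  · have := hg i (by simpa using hi); linarith
  · have h1 : ∑ i ∈ range p, (-1 : ℤ) ^ i * ((p - 1).choose i : ℤ) = 0 := by
      have := Int.alternating_sum_range_choose (n := p - 1)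
      rw [show p - 1 + 1 = p by have := hp.two_le; omega] at this
      rw [this, if_neg (by have := hp.two_le; omega)]
    have h2 : ∑ i ∈ range p, (-1 : ℤ) ^ i * ((p - 1).choose i : ℤ) =
        ∑ i ∈ range p, (1 + (p : ℤ) * g i) :=
      sum_congr rfl fun i hi => by have := hg i (by simpa using hi); linarith
    rw [h1, sum_add_distrib, ← mul_sum] at h2
    simp at h2
    have hp0 : (p : ℤ) ≠ 0 := by exact_mod_cast hp.ne_zero
    apply mul_left_cancel₀ hp0
    linarith

/-- The key polynomial identity. -/
lemma poly_identity {K : Type*} [CommRing K] [IsDomain K] [CharZero K] (A B C : K)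
    (hAB : A - B ≠ 0) (hBC : B - C ≠ 0) (p : ℕ) (hp : p.Prime) (g : ℕ → ℤ)
    (hg : ∀ i ∈ range p, (-1 : ℤ) ^ i * ((p - 1).choose i : ℤ) = 1 + p * g i) :
    ∑ l ∈ range (p - 1), ((p.choose (l + 1) / p : ℕ) : K) *
        ((A - B) ^ l * (B - C) ^ (p - 2 - l)) =
      (-1) ^ (p - 1) * ∑ i ∈ range p, (g i : K) * Dpoly A B C (p - 1) i := by
  have hp0 : (p : K) ≠ 0 := by exact_mod_cast hp.ne_zero
  have hpp : p - 1 + 1 = p := by have := hp.two_le; omega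
  apply mul_left_cancel₀ hp0
  apply mul_right_cancel₀ (mul_ne_zero hAB hBC)
  rw [binom_mid _ _ _ hp]
  have h1 := sum_Dpoly_mul A B C (p - 1)
  have h2 := sum_fDpoly_mul A B C (p - 1)
  rw [hpp] at h1 h2
  have h3 : ∑ i ∈ range p, ((-1 : K) ^ i * ((p - 1).choose i : K)) * Dpoly A B C (p - 1) i =
      ∑ i ∈ range p, Dpoly A B C (p - 1) i +
        p * ∑ i ∈ range p, (g i : K) * Dpoly A B C (p - 1) i := by
    rw [mul_sum, ← sum_add_distrib]
    refine sum_congr rfl fun i hi => ?_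
    have := congrArg (Int.cast : ℤ → K) (hg i hi)
    push_cast at this
    rw [this]; ring
  rw [h3] at h2
  have hs : ((-1 : K) ^ (p - 1)) * (-1) ^ (p - 1) = 1 := by
    rw [← mul_pow]; simp
  have h4 : (p : K) * ((-1) ^ (p - 1) * ∑ i ∈ range p, (g i : K) * Dpoly A B C (p - 1) i) *
      ((A - B) * (B - C)) = ((-1) ^ (p-1) * (-1) ^ (p-1)) *
        ((A - C) ^ p - (B - C) ^ p - (A - B) ^ p) := by
    linear_combination (-1) ^ (p-1) * h2 - (-1)^(p-1) * h1
  rw [h4, hs]; ring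

section Theta
variable {E : Type*} [Ring E]

/-- The linear map `A^a B^b C^c ↦ R^a v R^b w R^c`. -/
noncomputable def Theta (R v w : E) : MvPolynomial (Fin 3) ℤ →ₗ[ℤ] E :=
  (MvPolynomial.basisMonomials (Fin 3) ℤ).constr ℤ
    fun s => R ^ (s 0) * v * R ^ (s 1) * w * R ^ (s 2)

lemma Theta_monomial (R v w : E) (s : Fin 3 →₀ ℕ) :
    Theta R v w (MvPolynomial.monomial s 1) = R ^ (s 0) * v * R ^ (s 1) * w * R ^ (s 2) := by
  have := (MvPolynomial.basisMonomials (Fin 3) ℤ).constr_basis ℤ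
    (fun s => R ^ (s 0) * v * R ^ (s 1) * w * R ^ (s 2)) s
  simpa [Theta] using this

lemma Theta_pow (R v w : E) (a b c : ℕ) :
    Theta R v w (MvPolynomial.X 0 ^ a * MvPolynomial.X 1 ^ b * MvPolynomial.X 2 ^ c) =
      R ^ a * v * R ^ b * w * R ^ c := by
  have : (MvPolynomial.X 0 ^ a * MvPolynomial.X 1 ^ b * MvPolynomial.X 2 ^ c :
      MvPolynomial (Fin 3) ℤ) = MvPolynomial.monomial
        (Finsupp.single 0 a + Finsupp.single 1 b + Finsupp.single 2 c) 1 := by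
    simp [MvPolynomial.X_pow_eq_monomial, MvPolynomial.monomial_mul]
  rw [this, Theta_monomial]
  simp

lemma Theta_AB (R v w : E) (P : MvPolynomial (Fin 3) ℤ) :
    Theta R v w ((MvPolynomial.X 0 - MvPolynomial.X 1) * P) = Theta R (R * v - v * R) w P := by
  have : (Theta R v w).comp (LinearMap.mulLeft ℤ (MvPolynomial.X 0 - MvPolynomial.X 1)) =
      Theta R (R * v - v * R) w := by
    refine (MvPolynomial.basisMonomials (Fin 3) ℤ).ext fun s => ?_
    simp only [MvPolynomial.coe_basisMonomials, LinearMap.comp_apply, LinearMap.mulLeft_apply,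
      sub_mul, map_sub, Theta_monomial, MvPolynomial.X, MvPolynomial.monomial_mul, one_mul]
    simp [pow_add, pow_one]
    rw [((Commute.refl R).pow_right (s 0)).eq]
    simp only [mul_sub, sub_mul, mul_assoc]
  exact congrArg (fun f => f P) this

lemma Theta_BC (R v w : E) (P : MvPolynomial (Fin 3) ℤ) :
    Theta R v w ((MvPolynomial.X 1 - MvPolynomial.X 2) * P) = Theta R v (R * w - w * R) P := by
  have : (Theta R v w).comp (LinearMap.mulLeft ℤ (MvPolynomial.X 1 - MvPolynomial.X 2)) =
      Theta R v (R * w - w * R) := by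
    refine (MvPolynomial.basisMonomials (Fin 3) ℤ).ext fun s => ?_
    simp only [MvPolynomial.coe_basisMonomials, LinearMap.comp_apply, LinearMap.mulLeft_apply,
      sub_mul, map_sub, Theta_monomial, MvPolynomial.X, MvPolynomial.monomial_mul, one_mul]
    simp [pow_add, pow_one]
    rw [((Commute.refl R).pow_right (s 1)).eq]
    simp only [mul_sub, sub_mul, mul_assoc]
  exact congrArg (fun f => f P) this

/-- iterated adjoint -/
def adIter (R : E) : ℕ → E → E
  | 0, v => v
  | (l + 1), v => adIter R l (R * v - v * R)

lemma Theta_pow_pow (R : E) (l m : ℕ) : ∀ v w : E,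
    Theta R v w ((MvPolynomial.X 0 - MvPolynomial.X 1) ^ l *
      (MvPolynomial.X 1 - MvPolynomial.X 2) ^ m) = adIter R l v * adIter R m w := by
  induction l with
  | zero =>
    induction m with
    | zero => intro v w; simpa [adIter] using Theta_pow R v w 0 0 0
    | succ m ih =>
      intro v w
      have := ih v (R * w - w * R)
      rw [pow_zero, one_mul] at this ⊢
      rw [pow_succ', Theta_BC, this]; rfl
  | succ l ih =>
    intro v w
    rw [pow_succ', mul_assoc, Theta_AB, ih]; rfl

lemma Theta_D (R v w : E) (m i : ℕ) :
    Theta R v w (Dpoly (MvPolynomial.X 0) (MvPolynomial.X 1) (MvPolynomial.X 2) m i) =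
      (∑ a ∈ range i, R ^ a * v * R ^ (i - 1 - a)) * w * R ^ (m - i) -
      R ^ i * v * ∑ b ∈ range (m - i), R ^ b * w * R ^ (m - i - 1 - b) := by
  have h1 : ∀ a ∈ range i, Theta R v w (MvPolynomial.X 0 ^ a * MvPolynomial.X 1 ^ (i - 1 - a) *
    MvPolynomial.X 2 ^ (m - i)) = (R ^ a * v * R ^ (i - 1 - a)) * w * R ^ (m - i) :=
      fun a _ => by rw [Theta_pow]
  have h2 : ∀ b ∈ range (m - i), Theta R v w (MvPolynomial.X 0 ^ i * (MvPolynomial.X 1 ^ b *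
    MvPolynomial.X 2 ^ (m - i - 1 - b))) = R ^ i * v * (R ^ b * w * R ^ (m - i - 1 - b)) :=
      fun a _ => by rw [← mul_assoc, Theta_pow]; simp only [mul_assoc]
  unfold Dpoly
  rw [map_sub, sum_mul, mul_sum, map_sum, map_sum, sum_congr rfl h1, sum_congr rfl h2,
    mul_sum, sum_mul, sum_mul]

lemma theta_identity (R v : E) (p : ℕ) (hp : p.Prime) (g : ℕ → ℤ)
    (hg : ∀ i ∈ range p, (-1 : ℤ) ^ i * ((p - 1).choose i : ℤ) = 1 + p * g i) :
    ∑ l ∈ range (p - 1), ((p.choose (l + 1) / p : ℕ) : ℤ) •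
        (adIter R l v * adIter R (p - 2 - l) v) =
      (-1 : ℤ) ^ (p - 1) • ∑ i ∈ range p, g i • 
        ((∑ a ∈ range i, R ^ a * v * R ^ (i - 1 - a)) * v * R ^ (p - 1 - i) -
      R ^ i * v * ∑ b ∈ range (p - 1 - i), R ^ b * v * R ^ (p - 1 - i - 1 - b)) := by
  have hne : ∀ i j : Fin 3, i ≠ j → (MvPolynomial.X i - MvPolynomial.X j :
      MvPolynomial (Fin 3) ℤ) ≠ 0 := fun i j hij h =>
    hij (MvPolynomial.X_injective (sub_eq_zero.mp h))
  have := congrArg (Theta R v v) (poly_identity (K := MvPolynomial (Fin 3) ℤ)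
    (MvPolynomial.X 0) (MvPolynomial.X 1) (MvPolynomial.X 2) (hne _ _ (by decide))
    (hne _ _ (by decide)) p hp g hg)
  rw [map_sum] at this
  have e : ((-1 : MvPolynomial (Fin 3) ℤ)) ^ (p - 1) = (((-1 : ℤ) ^ (p - 1) : ℤ) :
    MvPolynomial (Fin 3) ℤ) := by push_cast; rfl
  rw [e, ← zsmul_eq_mul, map_zsmul, map_sum] at this
  simp only [← zsmul_eq_mul, ← Int.cast_natCast (R := MvPolynomial (Fin 3) ℤ), map_zsmul,
    Theta_pow_pow, Theta_D] at this
  exact this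
end Theta
end PolyPart


section Grass
open Finset TensorProduct

/-- integral Grassmann algebra -/
def Grs (M : ℕ) : Type := ExteriorAlgebra ℤ (Fin M → ℤ)

noncomputable instance (M : ℕ) : Ring (Grs M) :=
  inferInstanceAs (Ring (ExteriorAlgebra ℤ (Fin M → ℤ)))

/-- Grassmann envelope -/
abbrev GS (S : Type) [Ring S] (M : ℕ) : Type := S ⊗[ℤ] Grs M

noncomputable def gθ (M : ℕ) (i : Fin M) : Grs M := ExteriorAlgebra.ι ℤ (Pi.single i 1)

noncomputable def gvolAux (M : ℕ) : ExteriorAlgebra ℤ (Fin M → ℤ) →ₗ[ℤ] ℤ :=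
  ExteriorAlgebra.liftAlternating (fun n => if h : n = M then
    (Matrix.detRowAlternating (n := Fin M) (R := ℤ)).domDomCongr (finCongr h.symm) else 0)

noncomputable def gvol (M : ℕ) : Grs M →ₗ[ℤ] ℤ :=
  AddMonoidHom.toIntLinearMap (gvolAux M).toAddMonoidHom

lemma gvol_ofFn (M : ℕ) (f : Fin M → Fin M) :
    gvol M (List.ofFn fun i => gθ M (f i)).prod =
      Matrix.det (Matrix.of fun i => (Pi.single (f i) 1 : Fin M → ℤ)) := by
  have := ExteriorAlgebra.ιMulti_apply (R := ℤ) (n := M)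
    (fun i => (Pi.single (f i) 1 : Fin M → ℤ))
  show gvolAux M (List.ofFn fun i => ExteriorAlgebra.ι ℤ (Pi.single (f i) 1)).prod = _
  rw [← this, gvolAux, ExteriorAlgebra.liftAlternating_apply_ιMulti]
  simp
  rfl

lemma gvol_perm (M : ℕ) (σ : Equiv.Perm (Fin M)) :
    gvol M (List.ofFn fun i => gθ M (σ i)).prod = Equiv.Perm.sign σ := by
  rw [gvol_ofFn]
  have h := Matrix.det_permutation (R := ℤ) σ
  simp only [Int.cast_id] at h
  rw [← h]
  congr 1
  ext i j
  simp [Pi.single_apply, Equiv.Perm.permMatrix, PEquiv.toMatrix_apply, eq_comm]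

lemma gθ_anti (M : ℕ) (i j : Fin M) : gθ M i * gθ M j = - (gθ M j * gθ M i) := by
  rw [eq_neg_iff_add_eq_zero]
  exact ExteriorAlgebra.ι_add_mul_swap _ _

lemma gθ_sq (M : ℕ) (i : Fin M) : gθ M i * gθ M i = 0 := ExteriorAlgebra.ι_sq_zero _

variable {S : Type} [Ring S] {M : ℕ}

noncomputable def ginc : S →+* GS S M := Algebra.TensorProduct.includeLeftRingHom
noncomputable def gincR : Grs M →+* GS S M :=
  (Algebra.TensorProduct.includeRight : Grs M →ₐ[ℤ] GS S M).toRingHom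

lemma ginc_comm (s : S) (b : Grs M) : (gincR b : GS S M) * ginc s = ginc s * gincR b := by
  simp [ginc, gincR]

noncomputable def gtop : GS S M →+ S :=
  ((TensorProduct.rid ℤ S).toLinearMap ∘ₗ (gvol M).lTensor S).toAddMonoidHom

lemma gtop_tmul (s : S) (b : Grs M) : gtop (s ⊗ₜ[ℤ] b : GS S M) = gvol M b • s := by
  show (TensorProduct.rid ℤ S) ((gvol M).lTensor S (s ⊗ₜ[ℤ] b)) = _
  rw [LinearMap.lTensor_tmul, TensorProduct.rid_tmul]

lemma gtop_apply (s : S) (b : Grs M) : gtop (ginc s * gincR b : GS S M) = gvol M b • s := by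
  simp [gtop_tmul, ginc, gincR]

noncomputable def gdAux (M : ℕ) : ExteriorAlgebra ℤ (Fin M → ℤ) →ₗ[ℤ]
    ExteriorAlgebra ℤ (Fin M → ℤ) :=
  CliffordAlgebra.contractLeft (Q := (0 : QuadraticForm ℤ (Fin M → ℤ)))
    (∑ i : Fin M, LinearMap.proj i)

noncomputable def gd (M : ℕ) : Grs M →ₗ[ℤ] Grs M :=
  AddMonoidHom.toIntLinearMap (gdAux M).toAddMonoidHom

lemma gd_θ (i : Fin M) (b : Grs M) : gd M (gθ M i * b) = b - gθ M i * gd M b := by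
  have h := CliffordAlgebra.contractLeft_ι_mul (Q := (0 : QuadraticForm ℤ (Fin M → ℤ)))
    (d := ∑ i : Fin M, LinearMap.proj i) (Pi.single i 1) (show CliffordAlgebra (0 : QuadraticForm ℤ (Fin M → ℤ)) from b)
  have h2 : (∑ i : Fin M, LinearMap.proj i : Module.Dual ℤ (Fin M → ℤ)) (Pi.single i 1) = 1 := by
    simp
  rw [h2, one_smul] at h
  exact h

lemma gd_one : gd M 1 = 0 := by
  exact CliffordAlgebra.contractLeft_one (Q := (0 : QuadraticForm ℤ (Fin M → ℤ)))
    (d := ∑ i : Fin M, LinearMap.proj i)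

noncomputable def gder : GS S M →+ GS S M := ((gd M).lTensor S).toAddMonoidHom

lemma gder_tmul (s : S) (b : Grs M) : gder (s ⊗ₜ[ℤ] b : GS S M) = s ⊗ₜ[ℤ] gd M b := by
  exact LinearMap.lTensor_tmul S (gd M) s b

lemma gder_θ (i : Fin M) (b : GS S M) :
    gder (gincR (gθ M i) * b) = b - gincR (gθ M i) * gder b := by
  induction b using TensorProduct.induction_on with
  | zero => simp
  | tmul s b =>
    simp [gder_tmul, gincR, gd_θ, TensorProduct.tmul_sub]
  | add x y hx hy =>
    rw [mul_add, map_add, hx, hy, map_add, mul_add]; abel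

lemma gder_inc (s : S) (b : GS S M) : gder (ginc s * b) = ginc s * gder b := by
  induction b using TensorProduct.induction_on with
  | zero => simp
  | tmul s b =>
    simp [gder_tmul, ginc]
  | add x y hx hy =>
    rw [mul_add, map_add, hx, hy, map_add, mul_add]

lemma gder_one : gder (1 : GS S M) = 0 := by
  simp [gder_tmul, gd_one, Algebra.TensorProduct.one_def]

noncomputable def gmap {S' : Type} [Ring S'] (φ : S →+* S') : GS S M →+* GS S' M :=
  (Algebra.TensorProduct.map φ.toIntAlgHom (AlgHom.id ℤ (Grs M))).toRingHom

lemma gmap_inc {S' : Type} [Ring S'] (φ : S →+* S') (s : S) :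
    gmap φ (ginc s : GS S M) = ginc (φ s) := by
  simp [gmap, ginc]

lemma gmap_incR {S' : Type} [Ring S'] (φ : S →+* S') (b : Grs M) :
    gmap φ (gincR b : GS S M) = gincR b := by
  simp [gmap, gincR]

lemma gtop_map {S' : Type} [Ring S'] (φ : S →+* S') (b : GS S M) :
    gtop (gmap φ b) = φ (gtop b) := by
  induction b using TensorProduct.induction_on with
  | zero => simp
  | tmul s b => simp [gmap, gtop_tmul]
  | add x y hx hy => simp [map_add, hx, hy]

end Grass


section Core
open Finset

def geoS {E : Type*} [Ring E] (R w : E) (n : ℕ) : E := ∑ a ∈ range n, R ^ a * w * R ^ (n - 1 - a)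

lemma geoS_succ {E : Type*} [Ring E] (R w : E) (n : ℕ) :
    geoS R w (n + 1) = w * R ^ n + R * geoS R w n := by
  unfold geoS
  rw [sum_range_succ', mul_sum, add_comm]
  congr 1
  · simp
  · refine sum_congr rfl fun a _ => ?_
    rw [pow_succ', show n + 1 - 1 - (a + 1) = n - 1 - a by omega]
    simp only [mul_assoc]

lemma geoS_neg_add {E : Type*} [Ring E] (R v w : E) (n : ℕ) :
    geoS R (-(v + w)) n = - geoS R v n - geoS R w n := by
  unfold geoS
  rw [← sum_neg_distrib, ← sum_sub_distrib]
  refine sum_congr rfl fun a _ => ?_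
  simp only [mul_add, add_mul, mul_neg, neg_mul, neg_add]
  abel

def MultE {E : Type*} [Ring E] (α β Y : E) (m i : ℕ) : E :=
  - (geoS (Y * Y) (α * Y - Y * α) i) * (β * Y - Y * β) * (Y * Y) ^ (m - i) +
    (Y * Y) ^ i * (β * Y - Y * β) * geoS (Y * Y) (α * Y - Y * α) (m - i) +
    (Y * Y) ^ i * (α * β - β * α) * (Y * Y) ^ (m - i)

lemma der_identity {E : Type*} [Ring E] (D : E →+ E) (α β Y : E)
    (hβ : ∀ b, D (β * b) = β * D b)
    (hY : ∀ b, D (Y * b) = -(α + β) * b - Y * D b) (h1 : D 1 = 0) (m i : ℕ)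
    (h0 : (Y * Y) ^ i * (β * Y - Y * β) * (Y * Y) ^ (m - i) = 0) :
    geoS (Y * Y) (β * Y - Y * β) i * (β * Y - Y * β) * (Y * Y) ^ (m - i) -
      (Y * Y) ^ i * (β * Y - Y * β) * geoS (Y * Y) (β * Y - Y * β) (m - i) =
    MultE α β Y m i := by
  set R := Y * Y with hR
  set v := β * Y - Y * β with hv
  set va := α * Y - Y * α with hva
  have dR : ∀ b, D (R * b) = -(v + va) * b + R * D b := by
    intro b
    rw [hR, mul_assoc, hY, hY, hv, hva]
    noncomm_ring
  have dv : ∀ b, D (v * b) = (α * β - β * α) * b - v * D b := by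
    intro b
    rw [hv, sub_mul, map_sub, mul_assoc, mul_assoc, hβ, hY, hY, hβ]
    noncomm_ring
  have dRp : ∀ (n : ℕ) (b : E), D (R ^ n * b) = geoS R (-(v + va)) n * b + R ^ n * D b := by
    intro n
    induction n with
    | zero => intro b; simp [geoS]
    | succ n ih =>
      intro b
      rw [pow_succ', mul_assoc, dR, ih, geoS_succ]
      simp only [mul_add, add_mul, mul_assoc, add_assoc]
  have h2 := congrArg D h0
  have h3 := dRp (m - i) 1
  rw [mul_one, mul_one, h1, mul_zero, add_zero] at h3
  rw [map_zero, mul_assoc, dRp, dv, h3, geoS_neg_add, geoS_neg_add] at h2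
  unfold MultE
  rw [← hR, ← hv, ← hva, ← sub_eq_zero, ← neg_eq_zero, ← h2]
  noncomm_ring

variable {S : Type} [Ring S] {M : ℕ}

noncomputable def th (l : List (Fin M)) : Grs M := (l.map (gθ M)).prod

lemma th_append (l m : List (Fin M)) : th (l ++ m) = th l * th m := by simp [th]

lemma gθ_mul_th (i : Fin M) (l : List (Fin M)) : gθ M i * th l = (-1) ^ l.length * (th l * gθ M i) := by
  induction l with
  | nil => simp [th]
  | cons j l ih =>
    have h : th (j :: l) = gθ M j * th l := by simp [th]
    rw [h, ← mul_assoc, gθ_anti, neg_mul, mul_assoc, ih, List.length_cons, pow_succ]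
    have hc : ((-1 : Grs M) ^ l.length) * gθ M j = gθ M j * (-1) ^ l.length :=
      ((Commute.neg_one_left (gθ M j)).pow_left l.length).eq
    rw [← mul_assoc (gθ M j), ← hc]
    noncomm_ring

lemma th_mul_th (l m : List (Fin M)) : th l * th m = (-1) ^ (l.length * m.length) * (th m * th l) := by
  induction l with
  | nil => simp [th]
  | cons j l ih =>
    have h : th (j :: l) = gθ M j * th l := by simp [th]
    rw [h, mul_assoc, ih, List.length_cons, add_mul, one_mul, pow_add]
    have hc : ((-1 : Grs M) ^ (l.length * m.length)) * gθ M j = gθ M j * (-1) ^ (l.length * m.length) :=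
      ((Commute.neg_one_left (gθ M j)).pow_left _).eq
    rw [← mul_assoc (gθ M j), ← hc, mul_assoc, ← mul_assoc (gθ M j), gθ_mul_th]
    simp only [mul_assoc]

lemma gθ_mul_th_zero (i : Fin M) (l : List (Fin M)) (h : i ∈ l) : gθ M i * th l = 0 := by
  obtain ⟨a, b, rfl⟩ := List.append_of_mem h
  have h2 : th (a ++ i :: b) = th a * (gθ M i * th b) := by simp [th]
  rw [h2, ← mul_assoc, gθ_mul_th, mul_assoc, mul_assoc, ← mul_assoc (gθ M i), gθ_sq]
  simp

lemma th_zero (l : List (Fin M)) (h : ¬ l.Nodup) : th l = 0 := by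
  induction l with
  | nil => simp at h
  | cons j l ih =>
    have h2 : th (j :: l) = gθ M j * th l := by simp [th]
    rw [h2]
    by_cases hj : j ∈ l
    · exact gθ_mul_th_zero j l hj
    · rw [ih, mul_zero]
      intro hl
      exact h (List.nodup_cons.mpr ⟨hj, hl⟩)

lemma th_zero_of_length (l : List (Fin M)) (h : M < l.length) : th l = 0 := by
  apply th_zero
  intro hl
  have := hl.length_le_card
  simp at this
  omega

/-- homogeneous pieces -/
noncomputable def KK (L : AddSubgroup S) (M d : ℕ) : AddSubgroup (GS S M) :=
  AddSubgroup.closure {g | ∃ s ∈ L, ∃ l : List (Fin M), l.length = d ∧ g = ginc s * gincR (th l)}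

lemma KK_induct2 {E : Type*} [AddCommGroup E] {L L' : AddSubgroup S} {d e : ℕ} (B : AddSubgroup E)
    (f : GS S M →+ GS S M →+ E)
    (hg : ∀ s ∈ L, ∀ t ∈ L', ∀ l m : List (Fin M), l.length = d → m.length = e →
      f (ginc s * gincR (th l)) (ginc t * gincR (th m)) ∈ B)
    {x y : GS S M} (hx : x ∈ KK L M d) (hy : y ∈ KK L' M e) : f x y ∈ B := by
  induction hx using AddSubgroup.closure_induction with
  | mem x hx =>
    obtain ⟨s, hs, l, hl, rfl⟩ := hx
    induction hy using AddSubgroup.closure_induction with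
    | mem y hy =>
      obtain ⟨t, ht, m, hm, rfl⟩ := hy
      exact hg s hs t ht l m hl hm
    | zero => simp [B.zero_mem]
    | add a b _ _ ha hb => rw [map_add]; exact B.add_mem ha hb
    | neg a _ ha => rw [map_neg]; exact B.neg_mem ha
  | zero => simp [B.zero_mem]
  | add a b _ _ ha hb => rw [map_add, AddMonoidHom.add_apply]; exact B.add_mem ha hb
  | neg a _ ha => rw [map_neg, AddMonoidHom.neg_apply]; exact B.neg_mem ha

lemma gen_mul (s t : S) (l m : List (Fin M)) :
    (ginc s * gincR (th l) : GS S M) * (ginc t * gincR (th m)) =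
      ginc (s * t) * gincR (th l * th m) := by
  rw [map_mul, map_mul, mul_assoc, ← mul_assoc (gincR (th l)), ginc_comm]
  simp only [mul_assoc]

lemma KK_mul {d e : ℕ} {x y : GS S M} (hx : x ∈ KK (⊤ : AddSubgroup S) M d)
    (hy : y ∈ KK (⊤ : AddSubgroup S) M e) : x * y ∈ KK (⊤ : AddSubgroup S) M (d + e) := by
  refine KK_induct2 (KK (⊤ : AddSubgroup S) M (d + e)) AddMonoidHom.mul ?_ hx hy
  intro s _ t _ l m hl hm
  apply AddSubgroup.subset_closure
  refine ⟨s * t, trivial, l ++ m, by simp [hl, hm], ?_⟩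
  rw [th_append]
  exact gen_mul s t l m

lemma KK_zero {L : AddSubgroup S} {d : ℕ} (hd : M < d) {x : GS S M} (hx : x ∈ KK L M d) : x = 0 := by
  induction hx using AddSubgroup.closure_induction with
  | mem x hx =>
    obtain ⟨s, hs, l, hl, rfl⟩ := hx
    rw [th_zero_of_length l (by omega)]; simp
  | zero => rfl
  | add a b _ _ ha hb => rw [ha, hb, add_zero]
  | neg a _ ha => rw [ha, neg_zero]

lemma KK_comm {L L' L'' : AddSubgroup S} (hL : ∀ s ∈ L, ∀ t ∈ L', s * t - t * s ∈ L'')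
    {d e : ℕ} (hd : Even d) {x y : GS S M} (hx : x ∈ KK L M d)
    (hy : y ∈ KK L' M e) : x * y - y * x ∈ KK L'' M (d + e) := by
  refine KK_induct2 (KK L'' M (d + e)) (AddMonoidHom.mul - AddMonoidHom.mul.flip) ?_ hx hy
  intro s hs t ht l m hl hm
  apply AddSubgroup.subset_closure
  refine ⟨s * t - t * s, hL s hs t ht, l ++ m, by simp [hl, hm], ?_⟩
  show (ginc s * gincR (th l) : GS S M) * (ginc t * gincR (th m)) -
    (ginc t * gincR (th m)) * (ginc s * gincR (th l)) = _
  rw [gen_mul, gen_mul, th_append, th_mul_th m l, (show Even (m.length * l.length) from by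
    rw [hl]; exact hd.mul_left _).neg_one_pow, one_mul, ← sub_mul, ← map_sub]

lemma ring_aux {E : Type*} [Ring E] (a b c : E) : a * c + b * (-c) = (a - b) * c := by
  noncomm_ring

lemma KK_anti {L L' L'' : AddSubgroup S} (hL : ∀ s ∈ L, ∀ t ∈ L', s * t - t * s ∈ L'')
    {d e : ℕ} (hd : Odd d) (he : Odd e) {x y : GS S M} (hx : x ∈ KK L M d)
    (hy : y ∈ KK L' M e) : x * y + y * x ∈ KK L'' M (d + e) := by
  refine KK_induct2 (KK L'' M (d + e)) (AddMonoidHom.mul + AddMonoidHom.mul.flip) ?_ hx hy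
  intro s hs t ht l m hl hm
  apply AddSubgroup.subset_closure
  refine ⟨s * t - t * s, hL s hs t ht, l ++ m, by simp [hl, hm], ?_⟩
  show (ginc s * gincR (th l) : GS S M) * (ginc t * gincR (th m)) +
    (ginc t * gincR (th m)) * (ginc s * gincR (th l)) = _
  rw [gen_mul, gen_mul, th_append, th_mul_th m l, (show Odd (m.length * l.length) from by
    rw [hl, hm]; exact he.mul hd).neg_one_pow, neg_one_mul, map_neg, map_sub]
  exact ring_aux _ _ _

lemma KK_sq {L L'' : AddSubgroup S} (hL : ∀ s ∈ L, ∀ t ∈ L, s * t - t * s ∈ L'')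
    {d : ℕ} (hd : Odd d) {x : GS S M} (hx : x ∈ KK L M d) : x * x ∈ KK L'' M (d + d) := by
  induction hx using AddSubgroup.closure_induction with
  | mem x hx =>
    obtain ⟨s, hs, l, hl, rfl⟩ := hx
    have : th (l ++ l) = 0 := by
      apply th_zero
      obtain ⟨a, ha⟩ := List.exists_mem_of_ne_nil l (by rintro rfl; simp at hl; subst hl; simp at hd)
      intro h
      exact (List.nodup_append.mp h).2.2 a ha a ha rfl
    rw [gen_mul, ← th_append, this, map_zero, mul_zero]
    exact zero_mem _
  | zero => rw [mul_zero]; exact zero_mem _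
  | add a b ha hb iha ihb =>
    have := KK_anti hL hd hd ha hb
    have e : (a + b) * (a + b) = a * a + b * b + (a * b + b * a) := by noncomm_ring
    rw [e]
    exact add_mem (add_mem iha ihb) this
  | neg a _ ha => convert ha using 1; exact neg_mul_neg a a

lemma KK_top {L : AddSubgroup S} {d : ℕ} {x : GS S M} (hx : x ∈ KK L M d) : gtop x ∈ L := by
  induction hx using AddSubgroup.closure_induction with
  | mem x hx =>
    obtain ⟨s, hs, l, hl, rfl⟩ := hx
    rw [gtop_apply]
    exact zsmul_mem hs _
  | zero => rw [map_zero]; exact zero_mem _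
  | add a b _ _ ha hb => rw [map_add]; exact add_mem ha hb
  | neg a _ ha => rw [map_neg]; exact neg_mem ha

noncomputable def gY (x : Fin M → S) : GS S M := ∑ i, ginc (x i) * gincR (gθ M i)

lemma gY_mem (L : AddSubgroup S) (x : Fin M → S) (hx : ∀ i, x i ∈ L) : gY x ∈ KK L M 1 := by
  refine sum_mem fun i _ => AddSubgroup.subset_closure ⟨x i, hx i, [i], rfl, ?_⟩
  simp [th]

lemma ginc_mem (L : AddSubgroup S) (x : S) (hx : x ∈ L) : (ginc x : GS S M) ∈ KK L M 0 :=
  AddSubgroup.subset_closure ⟨x, hx, [], rfl, by simp [th]⟩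

lemma gder_Y (x : Fin M → S) (b : GS S M) :
    gder (gY x * b) = ginc (∑ i, x i) * b - gY x * gder b := by
  unfold gY
  rw [sum_mul, map_sum, map_sum, sum_mul, sum_mul, ← sum_sub_distrib]
  refine sum_congr rfl fun i _ => ?_
  rw [mul_assoc, gder_inc, gder_θ, mul_sub, mul_assoc]

/-- the total element -/
noncomputable def ZZ (p : ℕ) (g : ℕ → ℤ) (α β : S) (x : Fin M → S) : S :=
  gtop (((if p = 2 then 1 else 2) * (-1 : ℤ) ^ (p - 1)) • ∑ i ∈ range p, g i •
    MultE (ginc α) (ginc β) (gY x) (p - 1) i)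

lemma adIter_mem {L : ℕ → AddSubgroup S}
    (hL : ∀ a b, ∀ s ∈ L a, ∀ t ∈ L b, s * t - t * s ∈ L (a + b)) (R : GS S M)
    (hR : R ∈ KK (L 2) M 2) (l : ℕ) : ∀ (a d : ℕ) (v : GS S M), v ∈ KK (L a) M d →
      adIter R l v ∈ KK (L (2 * l + a)) M (2 * l + d) := by
  induction l with
  | zero => intro a d v hv; simpa [adIter] using hv
  | succ l ih =>
    intro a d v hv
    have := ih (2 + a) (2 + d) _ (KK_comm (hL 2 a) (by decide) hR hv)
    rw [show 2 * (l + 1) + a = 2 * l + (2 + a) by ring,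
      show 2 * (l + 1) + d = 2 * l + (2 + d) by ring]
    exact this

lemma ZZ_mem (p : ℕ) (hp : p.Prime) (hM : M = 2 * (p - 1)) (g : ℕ → ℤ)
    (hg : ∀ i ∈ range p, (-1 : ℤ) ^ i * ((p - 1).choose i : ℤ) = 1 + p * g i)
    (L : ℕ → AddSubgroup S)
    (hL : ∀ a b, ∀ s ∈ L a, ∀ t ∈ L b, s * t - t * s ∈ L (a + b))
    (α β : S) (x : Fin M → S) (hβ : β ∈ L 1) (hx : ∀ i, x i ∈ L 1)
    (hsum : ∑ i, x i + α + β = 0) : ZZ p g α β x ∈ L (2 * p) := by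
  have hp2 := hp.two_le
  have hY := gY_mem (L 1) x hx
  have hR := KK_sq (hL 1 1) (by decide) hY
  have hv := KK_comm (hL 1 1) (by decide) (ginc_mem (M := M) (L 1) β hβ) hY
  have hY' := gY_mem (⊤ : AddSubgroup S) x (fun _ => trivial)
  have hR' := KK_mul hY' hY'
  have hRp : ∀ n, (gY x * gY x) ^ n ∈ KK (⊤ : AddSubgroup S) M (2 * n) := by
    intro n
    induction n with
    | zero => simpa using ginc_mem (M := M) (⊤ : AddSubgroup S) 1 trivial
    | succ n ih => rw [pow_succ]; exact KK_mul ih hR'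
  have hβ' := ginc_mem (M := M) (⊤ : AddSubgroup S) β trivial
  have hv' : ginc β * gY x - gY x * ginc β ∈ KK (⊤ : AddSubgroup S) M 1 :=
    sub_mem (by simpa using KK_mul hβ' hY') (by simpa using KK_mul hY' hβ')
  unfold ZZ
  have hk : ∀ i ∈ range p, g i • MultE (ginc α) (ginc β) (gY x) (p - 1) i =
      g i • (geoS (gY x * gY x) (ginc β * gY x - gY x * ginc β) i *
        (ginc β * gY x - gY x * ginc β) * (gY x * gY x) ^ (p - 1 - i) -
      (gY x * gY x) ^ i * (ginc β * gY x - gY x * ginc β) *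
        geoS (gY x * gY x) (ginc β * gY x - gY x * ginc β) (p - 1 - i)) := by
    intro i hi
    rw [der_identity gder (ginc α) (ginc β) (gY x) (gder_inc β) _ gder_one]
    · apply KK_zero (d := 2 * i + 1 + 2 * (p - 1 - i)) (L := ⊤)
      · have : i < p := by simpa using hi
        omega
      · exact KK_mul (KK_mul (hRp i) hv') (hRp _)
    · intro b
      rw [gder_Y, ← map_add, ← map_neg]
      rw [show ∑ i, x i = -(α + β) by rw [eq_neg_iff_add_eq_zero, ← add_assoc]; exact hsum]
  rw [sum_congr rfl hk]
  have := theta_identity (gY x * gY x) (ginc β * gY x - gY x * ginc β) p hp g hg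
  change _ = (-1 : ℤ) ^ (p - 1) • ∑ i ∈ range p, g i •
     (geoS (gY x * gY x) (ginc β * gY x - gY x * ginc β) i *
        (ginc β * gY x - gY x * ginc β) * (gY x * gY x) ^ (p - 1 - i) -
      (gY x * gY x) ^ i * (ginc β * gY x - gY x * ginc β) *
        geoS (gY x * gY x) (ginc β * gY x - gY x * ginc β) (p - 1 - i)) at this
  rw [mul_smul, ← this]
  apply KK_top (d := 2 * (p - 1))
  by_cases h2 : p = 2
  · subst h2
    simpa [adIter] using KK_sq (hL 2 2) (by decide) hv
  · rw [if_neg h2]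
    set v := ginc β * gY x - gY x * ginc β
    set R := gY x * gY x
    have hrefl : ∑ l ∈ range (p - 1), ((p.choose (l + 1) / p : ℕ) : ℤ) •
        (adIter R l v * adIter R (p - 2 - l) v) = ∑ l ∈ range (p - 1),
          ((p.choose (l + 1) / p : ℕ) : ℤ) • (adIter R (p - 2 - l) v * adIter R l v) := by
      rw [← sum_range_reflect]
      refine sum_congr rfl fun l hl => ?_
      have hl' : l < p - 1 := by simpa using hl
      rw [show p - 1 - 1 - l + 1 = p - (l + 1) by omega, Nat.choose_symm (by omega),
        show p - 1 - 1 - l = p - 2 - l by omega, show p - 2 - (p - 2 - l) = l by omega]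
    rw [two_smul]
    nth_rewrite 2 [hrefl]
    rw [← sum_add_distrib]
    refine sum_mem fun l hl => ?_
    have hl' : l < p - 1 := by simpa using hl
    rw [← smul_add]
    apply zsmul_mem
    have h1 := adIter_mem hL R hR l 2 1 v hv
    have h2 := adIter_mem hL R hR (p - 2 - l) 2 1 v hv
    have := KK_anti (hL _ _) ⟨l, rfl⟩ ⟨p - 2 - l, rfl⟩ h1 h2
    rw [show 2 * l + 2 + (2 * (p - 2 - l) + 2) = 2 * p by omega,
      show 2 * l + 1 + (2 * (p - 2 - l) + 1) = 2 * (p - 1) by omega] at this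
    exact this
end Core


section Univ
open Finset

lemma map_MultE {E E' : Type*} [Ring E] [Ring E'] (φ : E →+* E') (α β Y : E) (m i : ℕ) :
    φ (MultE α β Y m i) = MultE (φ α) (φ β) (φ Y) m i := by
  simp [MultE, geoS, map_sum]

variable {S : Type} [Ring S] {M : ℕ}

lemma gmap_Y {S' : Type} [Ring S'] (φ : S →+* S') (x : Fin M → S) :
    gmap φ (gY x) = gY (fun i => φ (x i)) := by
  simp [gY, map_sum, gmap_inc, gmap_incR]

lemma ZZ_map {S' : Type} [Ring S'] (φ : S →+* S') (p : ℕ) (g : ℕ → ℤ) (α β : S) (x : Fin M → S) :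
    φ (ZZ p g α β x) = ZZ p g (φ α) (φ β) (fun i => φ (x i)) := by
  unfold ZZ
  rw [← gtop_map, map_zsmul, map_sum]
  simp only [map_zsmul, map_MultE, gmap_inc, gmap_Y]

noncomputable def thq (M : ℕ) (j : Fin (M + 2)) : Grs M :=
  if h : j.val < M then gθ M ⟨j, h⟩ else 1

def dg (M : ℕ) (j : Fin (M + 2)) : ℕ × ℕ × ℕ :=
  if j.val < M then (0, 0, 1) else if j.val = M then (1, 0, 0) else (0, 1, 0)

lemma thq_prod (l : List (Fin (M + 2))) : (l.map (thq M)).prod =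
    th (l.filterMap fun j : Fin (M + 2) => if h : j.val < M then some ⟨j, h⟩ else none) := by
  induction l with
  | nil => simp [th]
  | cons j l ih =>
    rw [List.map_cons, List.prod_cons, ih]
    by_cases h : j.val < M
    · simp [h, thq, th]
    · simp [h, thq]

lemma dup_zero (l : List (Fin (M + 2))) (h : ¬ l.Nodup) : (l.map (thq M)).prod = 0 ∨
    2 ≤ (l.map (dg M)).sum.1 ∨ 2 ≤ (l.map (dg M)).sum.2.1 := by
  induction l with
  | nil => simp at h
  | cons j l ih =>
    by_cases hj : j ∈ l
    · by_cases h1 : j.val < M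
      · left
        rw [List.map_cons, List.prod_cons, thq_prod]
        have : thq M j = gθ M ⟨j, h1⟩ := by simp [thq, h1]
        rw [this]
        apply gθ_mul_th_zero
        rw [List.mem_filterMap]
        exact ⟨j, hj, by simp [h1]⟩
      · right
        obtain ⟨a, b, rfl⟩ := List.append_of_mem hj
        by_cases h2 : j.val = M
        · left
          simp [dg, h2]; omega
        · right
          simp [dg, h1, h2]; omega
    · have hl : ¬ l.Nodup := fun hl => h (List.nodup_cons.mpr ⟨hj, hl⟩)
      rcases ih hl with h1 | h1 | h1
      · left; simp [h1]
      · right; left; simp; omega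
      · right; right; simp; omega

lemma dg_length (l : List (Fin (M + 2))) :
    (l.map (dg M)).sum.1 + (l.map (dg M)).sum.2.1 + (l.map (dg M)).sum.2.2 = l.length := by
  induction l with
  | nil => simp
  | cons j l ih =>
    have : (dg M j).1 + (dg M j).2.1 + (dg M j).2.2 = 1 := by
      unfold dg; split_ifs <;> simp
    simp only [List.map_cons, List.sum_cons, Prod.fst_add, Prod.snd_add, List.length_cons]
    omega

noncomputable def ωw (z : Fin (M + 2) → S) (l : List (Fin (M + 2))) : GS S M :=
  (l.map fun j => ginc (z j) * gincR (thq M j)).prod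

lemma ωw_eq (z : Fin (M + 2) → S) (l : List (Fin (M + 2))) :
    ωw z l = ginc (l.map z).prod * gincR (l.map (thq M)).prod := by
  unfold ωw
  induction l with
  | nil => simp
  | cons j l ih =>
    rw [List.map_cons, List.prod_cons, ih, List.map_cons, List.map_cons, List.prod_cons,
      List.prod_cons, map_mul, map_mul, mul_assoc, ← mul_assoc (gincR (thq M j)), ginc_comm]
    simp only [mul_assoc]

noncomputable def GG (z : Fin (M + 2) → S) (d : ℕ × ℕ × ℕ) : AddSubgroup (GS S M) :=
  AddSubgroup.closure {g | ∃ l : List (Fin (M + 2)), (l.map (dg M)).sum = d ∧ g = ωw z l}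

lemma GG_mul (z : Fin (M + 2) → S) {d e : ℕ × ℕ × ℕ} {x y : GS S M} (hx : x ∈ GG z d)
    (hy : y ∈ GG z e) : x * y ∈ GG z (d + e) := by
  induction hx using AddSubgroup.closure_induction with
  | mem x hx =>
    obtain ⟨l, hl, rfl⟩ := hx
    induction hy using AddSubgroup.closure_induction with
    | mem y hy =>
      obtain ⟨m, hm, rfl⟩ := hy
      apply AddSubgroup.subset_closure
      exact ⟨l ++ m, by simp [hl, hm], by simp [ωw]⟩
    | zero => rw [mul_zero]; exact zero_mem _
    | add a b _ _ ha hb => rw [mul_add]; exact add_mem ha hb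
    | neg a _ ha => convert neg_mem ha using 1; exact mul_neg (ωw z l) a
  | zero => rw [zero_mul]; exact zero_mem _
  | add a b _ _ ha hb => rw [add_mul]; exact add_mem ha hb
  | neg a _ ha => convert neg_mem ha using 1; exact neg_mul a y

lemma GG_pow (z : Fin (M + 2) → S) {d : ℕ × ℕ × ℕ} {x : GS S M} (hx : x ∈ GG z d) (n : ℕ) :
    x ^ n ∈ GG z (n • d) := by
  induction n with
  | zero =>
    rw [pow_zero, zero_smul]
    exact AddSubgroup.subset_closure ⟨[], by simp, by simp [ωw]⟩
  | succ n ih => rw [pow_succ, succ_nsmul]; exact GG_mul z ih hx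

lemma GG_congr (z : Fin (M + 2) → S) {d e : ℕ × ℕ × ℕ} {x : GS S M} (hx : x ∈ GG z d)
    (h : d = e) : x ∈ GG z e := h ▸ hx

lemma GG_letter (z : Fin (M + 2) → S) (j : Fin (M + 2)) :
    (ginc (z j) * gincR (thq M j) : GS S M) ∈ GG z (dg M j) :=
  AddSubgroup.subset_closure ⟨[j], by simp, by simp [ωw]⟩

lemma GG_geo (z : Fin (M + 2) → S) {d e : ℕ × ℕ × ℕ} {R w : GS S M} (hR : R ∈ GG z d)
    (hw : w ∈ GG z e) (n : ℕ) : geoS R w n ∈ GG z (e + (n - 1) • d) := by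
  unfold geoS
  refine sum_mem fun a ha => ?_
  have ha' : a < n := by simpa using ha
  refine GG_congr z (GG_mul z (GG_mul z (GG_pow z hR a) hw) (GG_pow z hR (n - 1 - a))) ?_
  rw [show n - 1 = a + (n - 1 - a) by omega, add_smul]
  simp only [show a + (n - 1 - a) - a = n - 1 - a by omega]
  abel

lemma Mult_mem (z : Fin (M + 2) → S) (m i : ℕ) (hi : i ≤ m) (hM : M = 2 * m) :
    MultE (ginc (z (Fin.last M).castSucc)) (ginc (z (Fin.last (M + 1))))
      (gY fun i => z i.castSucc.castSucc) m i ∈ GG z (1, 1, M) := by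
  have hα : (ginc (z (Fin.last M).castSucc) : GS S M) ∈ GG z (1, 0, 0) := by
    simpa [thq, dg] using GG_letter z (Fin.last M).castSucc
  have hβ : (ginc (z (Fin.last (M + 1))) : GS S M) ∈ GG z (0, 1, 0) := by
    simpa [thq, dg] using GG_letter z (Fin.last (M + 1))
  have hY : (gY fun i => z i.castSucc.castSucc : GS S M) ∈ GG z (0, 0, 1) := by
    refine sum_mem fun i _ => ?_
    simpa [thq, dg] using GG_letter z i.castSucc.castSucc
  have hR := GG_mul z hY hY
  have hv : (ginc (z (Fin.last (M + 1))) * (gY fun i => z i.castSucc.castSucc) -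
      (gY fun i => z i.castSucc.castSucc) * ginc (z (Fin.last (M + 1))) : GS S M) ∈
        GG z (0, 1, 1) :=
    sub_mem (GG_congr z (GG_mul z hβ hY) rfl) (GG_congr z (GG_mul z hY hβ) rfl)
  have hva : (ginc (z (Fin.last M).castSucc) * (gY fun i => z i.castSucc.castSucc) -
      (gY fun i => z i.castSucc.castSucc) * ginc (z (Fin.last M).castSucc) : GS S M) ∈
        GG z (1, 0, 1) :=
    sub_mem (GG_congr z (GG_mul z hα hY) rfl) (GG_congr z (GG_mul z hY hα) rfl)
  have hab : (ginc (z (Fin.last M).castSucc) * ginc (z (Fin.last (M + 1))) -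
      ginc (z (Fin.last (M + 1))) * ginc (z (Fin.last M).castSucc) : GS S M) ∈
        GG z (1, 1, 0) :=
    sub_mem (GG_congr z (GG_mul z hα hβ) rfl) (GG_congr z (GG_mul z hβ hα) rfl)
  unfold MultE
  refine add_mem (add_mem ?_ ?_) ?_
  · rcases Nat.eq_zero_or_pos i with rfl | h
    · simp [geoS, zero_mem]
    · refine GG_congr z (GG_mul z (GG_mul z (neg_mem (GG_geo z hR hva i)) hv)
        (GG_pow z hR (m - i))) ?_
      simp; omega
  · rcases Nat.eq_zero_or_pos (m - i) with h | h
    · simp [h, geoS, zero_mem]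
    · refine GG_congr z (GG_mul z (GG_mul z (GG_pow z hR i) hv) (GG_geo z hR hva (m - i))) ?_
      simp; omega
  · refine GG_congr z (GG_mul z (GG_mul z (GG_pow z hR i) hab) (GG_pow z hR (m - i))) ?_
    simp; omega

lemma nodup_perm {n : ℕ} (l : List (Fin n)) (hl : l.Nodup) (hn : l.length = n) :
    ∃ π : Equiv.Perm (Fin n), l = List.ofFn π := by
  have hinj : Function.Injective (fun i : Fin n => l.get (i.cast hn.symm)) := by
    intro i j hij
    have := List.nodup_iff_injective_get.mp hl hij
    simpa using this
  refine ⟨Equiv.ofBijective _ (Finite.injective_iff_bijective.mp hinj), ?_⟩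
  apply List.ext_get
  · simp [hn]
  · intro k h1 h2
    simp

/-- product along a permutation -/
def pw {n : ℕ} {S : Type*} [Ring S] (x : Fin n → S) (π : Fin n → Fin n) : S :=
  (List.ofFn fun i => x (π i)).prod

lemma map_pw {n : ℕ} {S S' : Type*} [Ring S] [Ring S'] (φ : S →+* S') (x : Fin n → S)
    (π : Fin n → Fin n) : φ (pw x π) = pw (fun i => φ (x i)) π := by
  simp [pw, map_list_prod, List.map_ofFn, Function.comp_def]

lemma closure_range {ι E : Type*} [Fintype ι] [AddCommGroup E] (w : ι → E) (e : E)
    (he : e ∈ AddSubgroup.closure (Set.range w)) : ∃ z : ι → ℤ, e = ∑ i, z i • w i := by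
  classical
  induction he using AddSubgroup.closure_induction with
  | mem x hx =>
    obtain ⟨i, rfl⟩ := hx
    exact ⟨Pi.single i 1, by simp [Pi.single_apply]⟩
  | zero => exact ⟨0, by simp⟩
  | add a b _ _ ha hb =>
    obtain ⟨u, rfl⟩ := ha
    obtain ⟨v, rfl⟩ := hb
    exact ⟨u + v, by simp [add_smul, sum_add_distrib]⟩
  | neg a _ ha =>
    obtain ⟨u, rfl⟩ := ha
    exact ⟨-u, by simp⟩

lemma GG_top (z : Fin (M + 2) → S) {x : GS S M} (hx : x ∈ GG z (1, 1, M)) :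
    gtop x ∈ AddSubgroup.closure (Set.range fun π : Equiv.Perm (Fin (M + 2)) => pw z π) := by
  induction hx using AddSubgroup.closure_induction with
  | mem x hx =>
    obtain ⟨l, hl, rfl⟩ := hx
    rw [ωw_eq, gtop_apply]
    by_cases hn : l.Nodup
    · have hlen := dg_length l
      rw [hl] at hlen
      obtain ⟨π, rfl⟩ := nodup_perm l hn (by simp at hlen; omega)
      apply zsmul_mem
      apply AddSubgroup.subset_closure
      exact ⟨π, by simp [pw, List.map_ofFn, Function.comp_def]⟩
    · rcases dup_zero l hn with h | h | h
      · rw [h, map_zero, zero_smul]; exact zero_mem _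
      · rw [hl] at h; simp at h
      · rw [hl] at h; simp at h
  | zero => rw [map_zero]; exact zero_mem _
  | add a b _ _ ha hb => rw [map_add]; exact add_mem ha hb
  | neg a _ ha => rw [map_neg]; exact neg_mem ha

/-- universal coefficients -/
lemma exists_univ (p : ℕ) (hM : M = 2 * (p - 1)) (g : ℕ → ℤ) :
    ∃ z : Equiv.Perm (Fin (M + 2)) → ℤ, ∀ (S : Type) (_ : Ring S) (x : Fin (M + 2) → S),
      ∑ π, z π • pw x π =
      ZZ p g (x (Fin.last M).castSucc) (x (Fin.last (M + 1))) (fun i => x i.castSucc.castSucc) := by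
  have h : ZZ p g (FreeAlgebra.ι ℤ (Fin.last M).castSucc) (FreeAlgebra.ι ℤ (Fin.last (M + 1)))
      (fun i : Fin M => FreeAlgebra.ι ℤ i.castSucc.castSucc) ∈
      AddSubgroup.closure (Set.range fun π : Equiv.Perm (Fin (M + 2)) =>
        pw (FreeAlgebra.ι ℤ : Fin (M + 2) → FreeAlgebra ℤ (Fin (M + 2))) π) := by
    apply GG_top
    apply zsmul_mem
    refine sum_mem fun i hi => zsmul_mem (Mult_mem (FreeAlgebra.ι ℤ) (p - 1) i ?_ hM) _
    have : i < p := by simpa using hi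
    omega
  obtain ⟨z, hz⟩ := closure_range _ _ h
  refine ⟨z, fun S _ x => ?_⟩
  have := congrArg (FreeAlgebra.lift ℤ x).toRingHom hz
  rw [ZZ_map, map_sum] at this
  simp only [map_zsmul, map_pw] at this
  simpa using this.symm

end Univ


section Weyl
open Finset

lemma sq_sum_anti {E : Type*} [Ring E] (t : ℕ → E) (n : ℕ)
    (h : ∀ i < n, ∀ j < i, t j * t i + t i * t j = 0) :
    (∑ i ∈ range n, t i) * (∑ i ∈ range n, t i) = ∑ i ∈ range n, t i * t i := by
  induction n with
  | zero => simp
  | succ n ih =>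
    rw [sum_range_succ, sum_range_succ, ← ih (fun i hi => h i (by omega))]
    have : (∑ i ∈ range n, t i) * t n + t n * (∑ i ∈ range n, t i) = 0 := by
      rw [sum_mul, mul_sum, ← sum_add_distrib]
      exact sum_eq_zero fun j hj => h n (by omega) j (by simpa using hj)
    have e : (∑ i ∈ range n, t i + t n) * (∑ i ∈ range n, t i + t n) =
      (∑ i ∈ range n, t i) * (∑ i ∈ range n, t i) + t n * t n +
       ((∑ i ∈ range n, t i) * t n + t n * (∑ i ∈ range n, t i)) := by noncomm_ring
    rw [e, this, add_zero]

lemma add_nil_pow {E : Type*} [Ring E] (T t : E) (h : Commute T t) (h2 : t * t = 0) (n : ℕ) :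
    (T + t) ^ (n + 1) = T ^ (n + 1) + (n + 1) • (T ^ n * t) := by
  induction n with
  | zero => simp
  | succ n ih =>
    rw [pow_succ, ih, mul_add, add_mul, add_mul, ← pow_succ, smul_mul_assoc, smul_mul_assoc,
      mul_assoc _ t t, h2, mul_zero, smul_zero, add_zero, mul_assoc, ← h.eq, ← mul_assoc,
      ← pow_succ, add_assoc, succ_nsmul' _ (n + 1), add_comm (T ^ (n+1) * t)]

lemma nil_sum_pow {E : Type*} [Ring E] (t : ℕ → E) (n : ℕ)
    (h : ∀ i < n, ∀ j < n, Commute (t i) (t j)) (h2 : ∀ i < n, t i * t i = 0) :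
    (∑ i ∈ range n, t i) ^ n = n.factorial • ((List.range n).map t).prod ∧
      (∑ i ∈ range n, t i) ^ (n + 1) = 0 := by
  induction n with
  | zero => simp
  | succ n ih =>
    obtain ⟨h3, h4⟩ := ih (fun i hi j hj => h i (by omega) j (by omega)) (fun i hi => h2 i (by omega))
    have hc : Commute (∑ i ∈ range n, t i) (t n) :=
      Commute.sum_left _ _ _ fun i hi => h i (by have : i < n := by simpa using hi
                                                 omega) n (by omega)
    rw [sum_range_succ, add_nil_pow _ _ hc (h2 n (by omega)),
      add_nil_pow _ _ hc (h2 n (by omega)), h4, pow_succ _ (n + 1), h4, h3]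
    constructor
    · rw [List.range_succ]
      simp [Nat.factorial_succ, mul_smul]
      noncomm_ring
    · simp

/-- Weyl letters -/
def IsWeyl {S : Type*} [Ring S] {n : ℕ} (W : Fin n → S) : Prop :=
  ∀ i j : Fin n, i < j → W i * W j - W j * W i = if (Even i.val ∧ j.val = i.val + 1) then 1 else 0

lemma sum_range_two {E : Type*} [AddCommMonoid E] (f : ℕ → E) (k : ℕ) :
    ∑ i ∈ range (2 * k), f i = ∑ i ∈ range k, (f (2 * i) + f (2 * i + 1)) := by
  induction k with
  | zero => simp
  | succ k ih =>
    rw [show 2 * (k + 1) = 2 * k + 1 + 1 by ring, sum_range_succ, sum_range_succ, ih,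
      sum_range_succ, add_assoc]

lemma prod_range_two {E : Type*} [Monoid E] (f : ℕ → E) (k : ℕ) :
    ((List.range (2 * k)).map f).prod =
      ((List.range k).map fun i => f (2 * i) * f (2 * i + 1)).prod := by
  induction k with
  | zero => simp
  | succ k ih =>
    rw [show 2 * (k + 1) = 2 * k + 1 + 1 by ring, List.range_succ, List.range_succ,
      List.range_succ (n := k)]
    simp [ih, mul_assoc]

variable {S : Type} [Ring S]

/-- extension of theta to all naturals -/
noncomputable def thN (M : ℕ) (n : ℕ) : Grs M := if h : n < M then gθ M ⟨n, h⟩ else 1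

lemma thN_prod (M : ℕ) : gvol M ((List.range M).map (thN M)).prod = 1 := by
  have := gvol_perm M 1
  simp only [Equiv.Perm.coe_one, id_eq, Equiv.Perm.sign_one] at this
  have e : (List.range M).map (thN M) = List.ofFn fun i => gθ M i := by
    apply List.ext_get
    · simp
    · intro n h1 h2
      simp at h1 h2
      simp [thN, h2]
  rw [e, this]; rfl

lemma gY_sq (k : ℕ) (W : Fin (2 * k) → S) (hW : IsWeyl W) :
    gY W * gY W = ∑ i ∈ range k, gincR (thN (2 * k) (2 * i) * thN (2 * k) (2 * i + 1)) := by
  set u : ℕ → GS S (2 * k) := fun n => if h : n < 2 * k then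
    ginc (W ⟨n, h⟩) * gincR (gθ (2 * k) ⟨n, h⟩) else 0 with hu
  have hY : gY W = ∑ i ∈ range k, (u (2 * i) + u (2 * i + 1)) := by
    rw [← sum_range_two, Finset.sum_range]
    refine sum_congr rfl fun i _ => ?_
    simp [hu]
  have hu2 : ∀ n, u n * u n = 0 := by
    intro n
    by_cases h : n < 2 * k
    · simp only [hu, h, dif_pos]
      rw [mul_assoc, ← mul_assoc (gincR _), ginc_comm, mul_assoc, ← map_mul, gθ_sq]
      simp
    · simp [hu, h]
  have huu : ∀ a b (ha : a < 2 * k) (hb : b < 2 * k), u a * u b + u b * u a =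
      ginc (W ⟨a, ha⟩ * W ⟨b, hb⟩ - W ⟨b, hb⟩ * W ⟨a, ha⟩) *
        gincR (thN (2 * k) a * thN (2 * k) b) := by
    intro a b ha hb
    simp only [hu, ha, hb, dif_pos, thN]
    rw [mul_assoc, ← mul_assoc (gincR _), ginc_comm, mul_assoc, ← map_mul, ← mul_assoc, ← map_mul]
    rw [mul_assoc (ginc (W ⟨b, hb⟩)), ← mul_assoc (gincR _), ginc_comm, mul_assoc (ginc _),
      ← map_mul, ← mul_assoc, ← map_mul, gθ_anti _ ⟨b, hb⟩ ⟨a, ha⟩, map_neg, map_sub]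
    exact ring_aux _ _ _
  rw [hY, sq_sum_anti]
  · refine sum_congr rfl fun i hi => ?_
    have hi' : i < k := by simpa using hi
    have e : (u (2 * i) + u (2 * i + 1)) * (u (2 * i) + u (2 * i + 1)) =
      u (2 * i) * u (2 * i) + u (2 * i + 1) * u (2 * i + 1) +
        (u (2 * i) * u (2 * i + 1) + u (2 * i + 1) * u (2 * i)) := by noncomm_ring
    rw [e, hu2, hu2, huu (2 * i) (2 * i + 1) (by omega) (by omega), hW _ _ (by simp [Fin.lt_def])]
    simp
  · intro i hi j hj
    have key : ∀ a b, a < 2 * k → b < 2 * k → a < b → ¬ (Even a ∧ b = a + 1) →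
        u a * u b + u b * u a = 0 := by
      intro a b ha hb hab hne
      rw [huu a b ha hb, hW _ _ (by simpa [Fin.lt_def] using hab), if_neg (by simpa using hne)]
      simp
    have e : (u (2 * j) + u (2 * j + 1)) * (u (2 * i) + u (2 * i + 1)) +
      (u (2 * i) + u (2 * i + 1)) * (u (2 * j) + u (2 * j + 1)) =
      (u (2 * j) * u (2 * i) + u (2 * i) * u (2 * j)) +
      (u (2 * j) * u (2 * i + 1) + u (2 * i + 1) * u (2 * j)) +
      (u (2 * j + 1) * u (2 * i) + u (2 * i) * u (2 * j + 1)) +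
      (u (2 * j + 1) * u (2 * i + 1) + u (2 * i + 1) * u (2 * j + 1)) := by noncomm_ring
    rw [e, key _ _ (by omega) (by omega) (by omega) (by omega),
      key _ _ (by omega) (by omega) (by omega) (by omega),
      key _ _ (by omega) (by omega) (by omega) (by
        rintro ⟨h, h2⟩; exact absurd h (by simp)),
      key _ _ (by omega) (by omega) (by omega) (by omega)]
    simp

lemma thN_anti (M a b : ℕ) (ha : a < M) (hb : b < M) :
    thN M a * thN M b = - (thN M b * thN M a) := by
  simp only [thN, ha, hb, dif_pos]; exact gθ_anti _ _ _

lemma top_weyl (k : ℕ) (W : Fin (2 * k) → S) (hW : IsWeyl W) :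
    gtop ((gY W * gY W) ^ k) = (k.factorial : S) := by
  rw [gY_sq k W hW]
  have := (nil_sum_pow (fun i => thN (2 * k) (2 * i) * thN (2 * k) (2 * i + 1)) k ?_ ?_).1
  · rw [← map_sum, ← map_pow, this, ← prod_range_two, map_nsmul, map_nsmul]
    have h2 := gtop_apply (1 : S) ((List.range (2 * k)).map (thN (2 * k))).prod
    rw [map_one, one_mul] at h2
    rw [h2, thN_prod]; simp
  · intro i hi j hj
    show _ * _ = _ * _
    simp only [mul_assoc]
    rw [← mul_assoc (thN _ (2 * i + 1)), thN_anti _ (2 * i + 1) (2 * j) (by omega) (by omega)]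
    rw [neg_mul, mul_neg, mul_assoc, thN_anti _ (2 * i + 1) (2 * j + 1) (by omega) (by omega)]
    rw [mul_neg, mul_neg, neg_neg, ← mul_assoc, thN_anti _ (2 * i) (2 * j) (by omega) (by omega)]
    rw [neg_mul, mul_assoc, ← mul_assoc (thN _ (2 * i)),
      thN_anti _ (2 * i) (2 * j + 1) (by omega) (by omega)]
    simp only [neg_mul, mul_neg, neg_neg, mul_assoc]
  · intro i hi
    have h0 : thN (2 * k) (2 * i) * thN (2 * k) (2 * i) = 0 := by
      simp only [thN, show 2 * i < 2 * k by omega, dif_pos]; exact gθ_sq _ _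
    rw [mul_assoc, ← mul_assoc (thN _ (2 * i + 1)),
      thN_anti _ (2 * i + 1) (2 * i) (by omega) (by omega), neg_mul, mul_neg, mul_assoc,
      ← mul_assoc, h0]
    simp

lemma sum_pow_fn {E : Type*} [Ring E] (M n : ℕ) (u : Fin M → E) :
    (∑ i, u i) ^ n = ∑ f : Fin n → Fin M, (List.ofFn fun i => u (f i)).prod := by
  have := (MultilinearMap.mkPiAlgebraFin ℤ n E).map_sum (fun (_ : Fin n) (j : Fin M) => u j)
  simpa [MultilinearMap.mkPiAlgebraFin_apply] using this

lemma gtop_Y_pow (M : ℕ) (W : Fin M → S) :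
    gtop (gY W ^ M) = ∑ σ : Equiv.Perm (Fin M), (Equiv.Perm.sign σ : ℤ) • pw W σ := by
  have h1 : ∀ l : List (Fin M), (l.map fun i => (ginc (W i) * gincR (gθ M i) : GS S M)).prod =
      ginc (l.map W).prod * gincR (th l) := by
    intro l
    induction l with
    | nil => simp [th]
    | cons j l ih =>
      have h2 : th (j :: l) = gθ M j * th l := by simp [th]
      rw [List.map_cons, List.prod_cons, ih, h2, List.map_cons, List.prod_cons, map_mul, map_mul,
        mul_assoc, ← mul_assoc (gincR _), ginc_comm]
      simp only [mul_assoc]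
  unfold gY
  rw [sum_pow_fn, map_sum]
  symm
  apply Fintype.sum_of_injective (fun σ : Equiv.Perm (Fin M) => (σ : Fin M → Fin M))
  · exact DFunLike.coe_injective
  · intro f hf
    have h3 := h1 (List.ofFn f)
    rw [List.map_ofFn] at h3
    simp only [Function.comp_def] at h3
    rw [h3, th_zero]
    · simp
    · rw [List.nodup_ofFn]
      intro hinj
      exact hf ⟨Equiv.ofBijective f (Finite.injective_iff_bijective.mp hinj), by ext; simp⟩
  · intro σ
    have h3 := h1 (List.ofFn σ)
    rw [List.map_ofFn] at h3
    simp only [Function.comp_def] at h3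
    rw [h3, gtop_apply]
    have h4 := gvol_perm M σ
    rw [th, List.map_ofFn]
    simp only [Function.comp_def]
    rw [h4, List.map_ofFn]; rfl

/-- alternating sum in Weyl letters -/
lemma alt_weyl (k : ℕ) (W : Fin (2 * k) → S) (hW : IsWeyl W) :
    ∑ σ : Equiv.Perm (Fin (2 * k)), (Equiv.Perm.sign σ : ℤ) • pw W σ = (k.factorial : S) := by
  rw [← gtop_Y_pow, pow_mul, sq, top_weyl k W hW]

lemma ZZ_weyl (p : ℕ) (k : ℕ) (hk : p = k + 1) (g : ℕ → ℤ) (hg : ∑ i ∈ range p, g i = -1)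
    (W : Fin (2 * k + 2) → S) (hW : IsWeyl W) :
    ZZ p g (W (Fin.last (2 * k)).castSucc) (W (Fin.last (2 * k + 1)))
      (fun i : Fin (2 * k) => W i.castSucc.castSucc) =
    (((if p = 2 then 1 else 2) * (-1 : ℤ) ^ (p - 1) * (-1) * k.factorial : ℤ) : S) := by
  have hc : ∀ (a : S), (∀ i : Fin (2 * k), W i.castSucc.castSucc * a - a * W i.castSucc.castSucc = 0) →
      ginc a * gY (fun i : Fin (2 * k) => W i.castSucc.castSucc) -
       gY (fun i : Fin (2 * k) => W i.castSucc.castSucc) * ginc a = 0 := by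
    intro a ha
    unfold gY
    rw [mul_sum, sum_mul, sub_eq_zero]
    refine sum_congr rfl fun i _ => ?_
    rw [mul_assoc, ginc_comm, ← mul_assoc, ← mul_assoc, ← map_mul, ← map_mul,
      sub_eq_zero.mp (ha i)]
  have h1 := hc (W (Fin.last (2 * k)).castSucc) (fun i => by
    rw [hW _ _ (by simp [Fin.lt_def]), if_neg]
    rintro ⟨h, h2⟩
    simp at h h2
    obtain ⟨c, hc⟩ := h
    omega)
  have h2 := hc (W (Fin.last (2 * k + 1))) (fun i => by
    rw [hW _ _ (by simp [Fin.lt_def]), if_neg]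
    rintro ⟨h, h2⟩
    simp at h h2
    obtain ⟨c, hc⟩ := h
    omega)
  have h3 : W (Fin.last (2 * k)).castSucc * W (Fin.last (2 * k + 1)) -
    W (Fin.last (2 * k + 1)) * W (Fin.last (2 * k)).castSucc = 1 := by
    rw [hW _ _ (by simp [Fin.lt_def]), if_pos]
    simp
  have hW' : IsWeyl (fun i : Fin (2 * k) => W i.castSucc.castSucc) := by
    intro i j hij
    rw [hW _ _ (show i.val < j.val from hij)]
    simp
  unfold ZZ
  have h4 : ∀ i ∈ range p, g i • MultE (ginc (W (Fin.last (2 * k)).castSucc))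
      (ginc (W (Fin.last (2 * k + 1)))) (gY fun i : Fin (2 * k) => W i.castSucc.castSucc) (p - 1) i
      = g i • ((gY fun i : Fin (2 * k) => W i.castSucc.castSucc) *
        (gY fun i : Fin (2 * k) => W i.castSucc.castSucc)) ^ k := by
    intro i hi
    have hi' : i < p := by simpa using hi
    unfold MultE
    rw [h1, h2, ← map_mul, ← map_mul, ← map_sub, h3, map_one]
    simp [geoS]
    rw [← pow_add, show i + (p - 1 - i) = k by omega]
  rw [sum_congr rfl h4, ← sum_smul, hg, map_zsmul, map_zsmul, top_weyl k _ hW']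
  simp [mul_assoc]

/-- The core lemma. -/
lemma core_lemma (p k : ℕ) (hp : p.Prime) (hk : p = k + 1) :
    ∃ z : Equiv.Perm (Fin (2 * k + 2)) → ℤ, ∃ κ : ℤ, ¬ (p : ℤ) ∣ κ ∧
      (∀ (S : Type) (_ : Ring S) (L : ℕ → AddSubgroup S),
        (∀ a b, ∀ s ∈ L a, ∀ t ∈ L b, s * t - t * s ∈ L (a + b)) →
        ∀ x : Fin (2 * k + 2) → S, (∀ i, x i ∈ L 1) → ∑ i, x i = 0 →
          ∑ π, z π • pw x π ∈ L (2 * p)) ∧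
      (∀ (S : Type) (_ : Ring S) (W : Fin (2 * k + 2) → S), IsWeyl W →
        ∑ π, z π • pw W π = (κ : S)) := by
  obtain ⟨g, hg, hg1⟩ := exists_g p hp
  obtain ⟨z, hz⟩ := exists_univ (M := 2 * k) p (by omega) g
  refine ⟨z, (if p = 2 then 1 else 2) * (-1 : ℤ) ^ (p - 1) * (-1) * k.factorial, ?_, ?_, ?_⟩
  · have hpi := Nat.prime_iff_prime_int.mp hp
    intro h
    rcases hpi.dvd_or_dvd h with h | h
    · rcases hpi.dvd_or_dvd h with h | h
      · rcases hpi.dvd_or_dvd h with h | h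
        · split_ifs at h with h2
          · exact hpi.not_dvd_one h
          · have : p ∣ 2 := by exact_mod_cast h
            exact h2 ((Nat.prime_dvd_prime_iff_eq hp Nat.prime_two).mp this)
        · have := hpi.dvd_of_dvd_pow h
          exact hpi.not_dvd_one (by simpa using this)
      · exact hpi.not_dvd_one (by simpa using h)
    · have : p ∣ k.factorial := by exact_mod_cast h
      have := (hp.dvd_factorial).mp this
      omega
  · intro S _ L hL x hx hs
    rw [hz]
    refine ZZ_mem p hp (by omega) g hg L hL _ _ _ (hx _) (fun i => hx _) ?_
    rw [Fin.sum_univ_castSucc, Fin.sum_univ_castSucc] at hs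
    exact hs
  · intro S _ W hW
    rw [hz, ZZ_weyl p k hk g hg1 W hW]

end Weyl


section Lift
open Finset

attribute [local instance 100] LieRing.ofAssociativeRing

lemma leftBracket_map {L L' : Type*} [LieRing L] [LieRing L'] [LieAlgebra ℤ L] [LieAlgebra ℤ L']
    (φ : L →ₗ⁅ℤ⁆ L') (l : List L) : φ (leftBracket l) = leftBracket (l.map φ) := by
  cases l with
  | nil => simp [leftBracket]
  | cons a l =>
    simp only [leftBracket, List.map_cons]
    induction l generalizing a with
    | nil => simp
    | cons b l ih => simp only [List.foldl_cons, List.map_cons, ih, LieHom.map_lie]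

lemma quot_lift {R M L : Type*} [CommRing R] [LieRing M] [LieAlgebra R M] [LieRing L]
    [LieAlgebra R L] (I : LieIdeal R M) (φ : M →ₗ⁅R⁆ L) (h : ∀ x ∈ I, φ x = 0) :
    ∃ F : (M ⧸ I) →ₗ⁅R⁆ L, ∀ x : M, F (LieSubmodule.Quotient.mk x) = φ x := by
  refine ⟨{ toLinearMap := Submodule.liftQ I.toSubmodule (φ : M →ₗ[R] L)
              (fun x hx => h x hx)
            map_lie' := ?_ }, ?_⟩
  · intro x y
    obtain ⟨x, rfl⟩ := LieSubmodule.Quotient.surjective_mk' _ x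
    obtain ⟨y, rfl⟩ := LieSubmodule.Quotient.surjective_mk' _ y
    exact LieHom.map_lie φ x y
  · intro g
    rfl

noncomputable def gMain (p : ℕ) (c : Fin (2 * p) → ℕ) (g : LieGen p c) : MainLie p c :=
  LieSubmodule.Quotient.mk (FreeLieAlgebra.of ℤ g)

noncomputable def qMain (p : ℕ) (c : Fin (2 * p) → ℕ) :
    FreeLieAlgebra ℤ (LieGen p c) →ₗ⁅ℤ⁆ MainLie p c :=
  { toFun := LieSubmodule.Quotient.mk
    map_add' := fun _ _ => rfl
    map_smul' := fun _ _ => rfl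
    map_lie' := rfl }

lemma gMain_sum (p : ℕ) (c : Fin (2 * p) → ℕ) : ∑ i, gMain p c (Sum.inl i) = 0 := by
  have : qMain p c (∑ i : Fin (2 * p), xLie p c i) = 0 := by
    refine (LieSubmodule.Quotient.mk_eq_zero' ).mpr ?_
    exact LieSubmodule.subset_lieSpan (Set.mem_insert _ _)
  rw [map_sum] at this
  exact this

lemma gMain_rel (p : ℕ) (c : Fin (2 * p) → ℕ) (i : Fin (2 * p)) :
    ((p ^ (c i) : ℕ) : ℤ) • gMain p c (Sum.inl i) =
      leftBracket (List.ofFn fun j : Fin (1 + c i) => gMain p c (Sum.inr ⟨i, j⟩)) := by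
  have : qMain p c ((p ^ (c i) : ℤ) • xLie p c i - yLie p c i) = 0 := by
    refine (LieSubmodule.Quotient.mk_eq_zero' ).mpr ?_
    exact LieSubmodule.subset_lieSpan (Set.mem_insert_of_mem _ ⟨i, rfl⟩)
  rw [map_sub, sub_eq_zero, map_smul, yLie, leftBracket_map, List.map_ofFn] at this
  push_cast
  exact this

lemma main_lift (p : ℕ) (c : Fin (2 * p) → ℕ) (L : Type*) [LieRing L] [LieAlgebra ℤ L]
    (f : LieGen p c → L) (h0 : ∑ i, f (Sum.inl i) = 0)
    (h1 : ∀ i, ((p ^ (c i) : ℕ) : ℤ) • f (Sum.inl i) =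
      leftBracket (List.ofFn fun j : Fin (1 + c i) => f (Sum.inr ⟨i, j⟩))) :
    ∃ F : MainLie p c →ₗ⁅ℤ⁆ L, ∀ g, F (gMain p c g) = f g := by
  set φ := FreeLieAlgebra.lift ℤ f with hφ
  have hle : ∀ x ∈ LieSubmodule.lieSpan ℤ (FreeLieAlgebra ℤ (LieGen p c)) (lieRels p c),
      φ x = 0 := by
    have : LieSubmodule.lieSpan ℤ (FreeLieAlgebra ℤ (LieGen p c)) (lieRels p c) ≤
        (show LieSubmodule ℤ (FreeLieAlgebra ℤ (LieGen p c)) (FreeLieAlgebra ℤ (LieGen p c)) from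
          φ.ker) := by
      refine LieSubmodule.lieSpan_le.mpr ?_
      rintro v (rfl | ⟨i, rfl⟩)
      · refine LieHom.mem_ker.mpr ?_
        simp only [map_sum, xLie]
        simpa [hφ, FreeLieAlgebra.lift_of_apply] using h0
      · refine LieHom.mem_ker.mpr ?_
        rw [map_sub, sub_eq_zero, map_zsmul, yLie, leftBracket_map, List.map_ofFn]
        have := h1 i
        push_cast at this
        simpa [hφ, xLie, FreeLieAlgebra.lift_of_apply, Function.comp_def] using this
    intro x hx
    exact LieHom.mem_ker.mp (this hx)
  obtain ⟨F, hF⟩ := quot_lift _ φ hle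
  refine ⟨F, fun g => ?_⟩
  exact (hF _).trans (FreeLieAlgebra.lift_of_apply _ _)

end Lift


section Filt
open Finset

attribute [local instance 100] LieRing.ofAssociativeRing

lemma nm_filter (p : ℕ) (c : Fin (2 * p) → ℕ) (E : Type) [Ring E] (G : ℕ → AddSubgroup E)
    (hG : ∀ a b, ∀ s ∈ G a, ∀ t ∈ G b, s * t - t * s ∈ G (a + b)) (h21 : G 2 ≤ G 1)
    (f : LieGen p c → E) (hf : ∀ g, f g ∈ G 1) (h0 : ∑ i, f (Sum.inl i) = 0)
    (h1 : ∀ i, ((p ^ (c i) : ℕ) : ℤ) • f (Sum.inl i) =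
      leftBracket (List.ofFn fun j : Fin (1 + c i) => f (Sum.inr ⟨i, j⟩)))
    (m : ℕ) (a : MainLie p c) (ha : a ∈ gammaLie (MainLie p c) (m + 1))
    (z : Equiv.Perm (Fin (2 * p)) → ℤ)
    (hz : UniversalEnvelopingAlgebra.ι ℤ a = ∑ π, ((z π : ℤ) : UniversalEnvelopingAlgebra ℤ (MainLie p c)) *
      pw (fun i => UniversalEnvelopingAlgebra.ι ℤ (gMain p c (Sum.inl i))) π) :
    ∑ π, ((z π : ℤ) : E) * pw (fun i => f (Sum.inl i)) π ∈ G (m + 1) := by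
  let K : LieSubalgebra ℤ E :=
    { carrier := G 1
      add_mem' := fun ha hb => (G 1).add_mem ha hb
      zero_mem' := (G 1).zero_mem
      smul_mem' := fun k x hx => (G 1).zsmul_mem hx k
      lie_mem' := fun {x y} hx hy => h21 (hG 1 1 x hx y hy) }
  let f' : LieGen p c → K := fun g => ⟨f g, hf g⟩
  have hinc : ∀ x : K, K.incl x = (x : E) := fun x => rfl
  obtain ⟨F, hF⟩ := main_lift p c K f' (by
      apply Subtype.ext
      rw [AddSubmonoidClass.coe_finset_sum]
      exact h0) (by
      intro i
      apply Subtype.ext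
      have h2 := leftBracket_map K.incl (List.ofFn fun j : Fin (1 + c i) => f' (Sum.inr ⟨i, j⟩))
      rw [List.map_ofFn] at h2
      refine Eq.trans ?_ h2.symm
      exact h1 i)
  have key : ∀ (k : ℕ) (b : MainLie p c), b ∈ LieModule.lowerCentralSeries ℤ (MainLie p c) (MainLie p c) k →
      ((F b : K) : E) ∈ G (k + 1) := by
    intro k
    induction k with
    | zero => intro b _; exact (F b).2
    | succ k ih =>
      intro b hb
      rw [LieModule.lowerCentralSeries_succ] at hb
      rw [← LieSubmodule.mem_toSubmodule, LieSubmodule.lieIdeal_oper_eq_linear_span'] at hb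
      induction hb using Submodule.span_induction with
      | mem x hx =>
        obtain ⟨u, -, v, hv, rfl⟩ := hx
        rw [LieHom.map_lie]
        have := hG 1 (k + 1) _ (F u).2 _ (ih v hv)
        rw [show k + 1 + 1 = 1 + (k + 1) by omega]
        exact this
      | zero => rw [map_zero]; exact (G _).zero_mem
      | add x y _ _ hx hy => rw [map_add]; exact (G _).add_mem hx hy
      | smul r x _ hx =>
        have : F (r • x) = r • F x := map_zsmul F r x
        rw [this]; exact (G _).zsmul_mem hx r
  have h3 := key m a ha
  let Φ := UniversalEnvelopingAlgebra.lift ℤ (K.incl.comp F)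
  have hΦ : ∀ b, Φ (UniversalEnvelopingAlgebra.ι ℤ b) = ((F b : K) : E) := fun b =>
    UniversalEnvelopingAlgebra.lift_ι_apply _ _ _
  rw [← hΦ a, hz, map_sum] at h3
  convert h3 using 1
  refine Finset.sum_congr rfl fun π _ => ?_
  have h4 : Φ (pw (fun i => UniversalEnvelopingAlgebra.ι ℤ (gMain p c (Sum.inl i))) π) =
      pw (fun i => f (Sum.inl i)) π := by
    refine (map_pw (Φ : UniversalEnvelopingAlgebra ℤ (MainLie p c) →+* E) _ _).trans ?_
    congr 1
    funext i
    refine (hΦ _).trans ?_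
    rw [hF]
  rw [map_mul, h4]
  congr 1
  exact (map_intCast Φ _).symm

end Filt


section Adj
open Finset Polynomial

attribute [local instance 100] LieRing.ofAssociativeRing

noncomputable def psiE (R : Type) [Ring R] : R[X] →+* AddMonoid.End R[X] :=
  Module.toAddMonoidEnd R[X] R[X]

noncomputable def derE (R : Type) [Ring R] : AddMonoid.End R[X] :=
  (Polynomial.derivative : R[X] →ₗ[R] R[X]).toAddMonoidHom

lemma psiE_apply (R : Type) [Ring R] (h q : R[X]) : psiE R h q = h * q := rfl
lemma derE_apply (R : Type) [Ring R] (q : R[X]) : derE R q = derivative q := rfl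

lemma derE_comm (R : Type) [Ring R] (h : R[X]) :
    derE R * psiE R h - psiE R h * derE R = psiE R (derivative h) := by
  rw [sub_eq_iff_eq_add]
  refine AddMonoidHom.ext fun q => ?_
  change derivative (h * q) = derivative h * q + h * derivative q
  exact Polynomial.derivative_mul

def GE (R : Type) [Ring R] (E : Type) [Ring E] (ps : R[X] →+* E) (D : E) (F : ℕ → AddSubgroup R) (m : ℕ) : AddSubgroup (E) where
  carrier := {T | ∃ (h : R[X]) (k : ℤ), T = ps h + k • D ∧ (2 ≤ m → k = 0) ∧
    ∀ j, (j.factorial : ℤ) • h.coeff j ∈ F (m + j)}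
  add_mem' := by
    rintro S T ⟨h, k, rfl, hk, hh⟩ ⟨h', k', rfl, hk', hh'⟩
    refine ⟨h + h', k + k', ?_, ?_, ?_⟩
    · rw [map_add, add_smul]; abel
    · intro hm; rw [hk hm, hk' hm]; rfl
    · intro j; rw [coeff_add, smul_add]; exact (F _).add_mem (hh j) (hh' j)
  zero_mem' := ⟨0, 0, by simp, fun _ => rfl, fun j => by simp [(F _).zero_mem]⟩
  neg_mem' := by
    rintro S ⟨h, k, rfl, hk, hh⟩
    refine ⟨-h, -k, ?_, ?_, ?_⟩
    · rw [map_neg, neg_smul]; abel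
    · intro hm; rw [hk hm]; rfl
    · intro j; rw [coeff_neg, smul_neg]; exact (F _).neg_mem (hh j)

lemma GE_comm (R : Type) [Ring R] (E : Type) [Ring E] (ps : R[X] →+* E) (D : E)
    (hD : ∀ h, D * ps h - ps h * D = ps (derivative h)) (F : ℕ → AddSubgroup R) (hanti : Antitone F)
    (hF : ∀ a b, ∀ s ∈ F a, ∀ t ∈ F b, s * t - t * s ∈ F (a + b)) :
    ∀ a b, ∀ s ∈ GE R E ps D F a, ∀ t ∈ GE R E ps D F b, s * t - t * s ∈ GE R E ps D F (a + b) := by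
  have hd : ∀ (a b : ℕ) (k : ℤ) (h : R[X]), (2 ≤ a → k = 0) →
      (∀ j, (j.factorial : ℤ) • h.coeff j ∈ F (b + j)) →
      ∀ j, (j.factorial : ℤ) • (k • derivative h).coeff j ∈ F (a + b + j) := by
    intro a b k h hk hh j
    by_cases ha : 2 ≤ a
    · rw [hk ha]; simp [(F _).zero_mem]
    · rw [coeff_smul, smul_comm]
      refine (F _).zsmul_mem ?_ k
      rw [coeff_derivative]
      have h2 := hanti (show a + b + j ≤ b + (j + 1) by omega) (hh (j + 1))
      convert h2 using 1
      rw [Nat.factorial_succ, zsmul_eq_mul, zsmul_eq_mul]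
      push_cast
      have : Commute (h.coeff (j+1)) ((j : R) + 1) := by
        have := (Nat.cast_commute (j + 1) (h.coeff (j+1))).symm
        push_cast at this; exact this
      rw [this.eq, ← mul_assoc]
      congr 1
      have h3 := (Nat.cast_commute (j.factorial) ((j : R) + 1))
      exact h3
  rintro a b S ⟨h, k, rfl, hk, hh⟩ T ⟨g, l, rfl, hl, hg⟩
  refine ⟨(h * g - g * h) + (k • derivative g - l • derivative h), 0, ?_, fun _ => rfl, ?_⟩
  · rw [map_add, map_sub, map_sub, map_mul, map_mul, map_zsmul, map_zsmul, ← hD, ← hD]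
    simp only [add_mul, mul_add, smul_mul_assoc, mul_smul_comm, zero_smul, add_zero, smul_sub]
    simp only [smul_add]
    rw [smul_comm k l]
    abel
  · intro j
    rw [coeff_add, coeff_sub (k • _), smul_add, smul_sub]
    refine (F _).add_mem ?_ ((F _).sub_mem (hd a b k g hk hg j) ?_)
    · rw [coeff_sub, coeff_mul, coeff_mul, ← Finset.Nat.sum_antidiagonal_swap (n := j) (f := fun x => g.coeff x.1 * h.coeff x.2), ← Finset.sum_sub_distrib, Finset.smul_sum]
      refine (F _).sum_mem fun x hx => ?_
      rw [HasAntidiagonal.mem_antidiagonal] at hx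
      have h1 := hF _ _ _ (hh x.1) _ (hg x.2)
      have h2 := (F _).zsmul_mem h1 (j.choose x.1 : ℤ)
      rw [show a + x.1 + (b + x.2) = a + b + j by omega] at h2
      convert h2 using 1
      simp only [smul_mul_assoc, mul_smul_comm, Prod.fst_swap, Prod.snd_swap, smul_smul, ← smul_sub]
      rw [mul_comm (x.2.factorial : ℤ), ← smul_sub, smul_smul]
      congr 1
      have := Nat.choose_mul_factorial_mul_factorial (show x.1 ≤ j by omega)
      rw [show j - x.1 = x.2 by omega] at this
      rw [← this]; push_cast; ring
    · have := hd b a l h hl hh j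
      rwa [show b + a + j = a + b + j by omega] at this

lemma fold_der (R : Type) [Ring R] (E : Type) [Ring E] (ps : R[X] →+* E) (D : E)
    (hD : ∀ h, D * ps h - ps h * D = ps (derivative h)) (r : R) (n c : ℕ) :
    (List.replicate c (-D)).foldl (fun x y => ⁅x, y⁆) (ps (monomial (n + c) r)) =
      ps (monomial n (((n + c).descFactorial c : ℕ) • r)) := by
  induction c generalizing r with
  | zero => simp
  | succ c ih =>
    rw [List.replicate_succ, List.foldl_cons]
    have : ⁅ps (monomial (n + (c + 1)) r), -D⁆ = ps (monomial (n + c) (r * ((n + c + 1 : ℕ) : R))) := by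
      rw [LieRing.of_associative_ring_bracket]
      have h := hD (monomial (n + (c + 1)) r)
      rw [derivative_monomial] at h
      rw [mul_neg, neg_mul, sub_neg_eq_add, neg_add_eq_sub, h]
      rfl
    rw [this, ih]
    congr 2
    rw [show n + (c + 1) = (n + c) + 1 by omega, Nat.succ_descFactorial_succ]
    rw [nsmul_eq_mul, nsmul_eq_mul, ← (Nat.cast_commute _ r).eq, ← mul_assoc]
    congr 1
    rw [← Nat.cast_mul, mul_comm]

lemma nm_adjoin0 (p : ℕ) (c : Fin (2 * p) → ℕ) (R : Type) [Ring R]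
    (E : Type) [Ring E] (ps : R[X] →+* E) (D : E)
    (hD : ∀ h, D * ps h - ps h * D = ps (derivative h)) (hinj : Function.Injective ps) (F : ℕ → AddSubgroup R)
    (hanti : Antitone F)
    (hF : ∀ a b, ∀ s ∈ F a, ∀ t ∈ F b, s * t - t * s ∈ F (a + b))
    (x r : Fin (2 * p) → R) (hx : ∀ i, x i ∈ F 1) (hx0 : ∑ i, x i = 0)
    (hr : ∀ i, (c i).factorial • r i = (p ^ c i) • x i)
    (hpx : ∀ i, (p ^ c i) • x i ∈ F (1 + c i))
    (m : ℕ) (a : MainLie p c) (ha : a ∈ gammaLie (MainLie p c) (m + 1))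
    (z : Equiv.Perm (Fin (2 * p)) → ℤ)
    (hz : UniversalEnvelopingAlgebra.ι ℤ a = ∑ π, ((z π : ℤ) : UniversalEnvelopingAlgebra ℤ (MainLie p c)) *
      pw (fun i => UniversalEnvelopingAlgebra.ι ℤ (gMain p c (Sum.inl i))) π) (hm : 1 ≤ m) :
    ∑ π, ((z π : ℤ) : R) * pw x π ∈ F (m + 1) := by
  let f : LieGen p c → E := fun g => match g with
    | Sum.inl i => ps (C (x i))
    | Sum.inr ⟨i, j⟩ => if j.val = 0 then ps (monomial (c i) (r i)) else -D
  have hmain := nm_filter p c E (GE R E ps D F) (GE_comm R E ps D hD F hanti hF) ?_ f ?_ ?_ ?_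
    m a ha z hz
  · obtain ⟨h, k, h1, h2, h3⟩ := hmain
    have h4 : (∑ π, ((z π : ℤ) : E) * pw (fun i => f (Sum.inl i)) π) =
        ps (C (∑ π, ((z π : ℤ) : R) * pw x π)) := by
      rw [map_sum, map_sum]
      refine Finset.sum_congr rfl fun π _ => ?_
      rw [map_mul, map_mul, map_intCast, map_intCast, map_pw, map_pw]
    rw [h4, h2 (by omega), zero_smul, add_zero] at h1
    have h5 := hinj h1
    have h6 := h3 0
    rw [← h5, coeff_C_zero] at h6
    simpa using h6
  · rintro T ⟨h, k, rfl, hk, hh⟩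
    exact ⟨h, k, rfl, fun h => by omega, fun j => hanti (by omega) (hh j)⟩
  · rintro (i | ⟨i, j⟩)
    · refine ⟨C (x i), 0, by simp [f], fun h => by omega, fun j => ?_⟩
      rw [coeff_C]
      split_ifs with h
      · subst h; simpa using hx i
      · simp [(F _).zero_mem]
    · by_cases hj : j.val = 0
      · refine ⟨monomial (c i) (r i), 0, by simp only [f]; simp [hj], fun h => by omega, fun j => ?_⟩
        rw [coeff_monomial]
        split_ifs with h
        · subst h
          have := hpx i
          rw [← hr] at this
          simpa using this
        · simp [(F _).zero_mem]
      · refine ⟨0, -1, by simp only [f]; simp [hj], fun h => by omega, fun j => ?_⟩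
        simp [(F _).zero_mem]
  · simp only [f]
    rw [← map_sum, ← map_sum, hx0, map_zero, map_zero]
  · intro i
    have h1 : (List.ofFn fun j : Fin (1 + c i) => f (Sum.inr ⟨i, j⟩)) =
        ps (monomial (0 + c i) (r i)) :: List.replicate (c i) (-D) := by
      rw [List.ofFn_congr (add_comm 1 (c i)), List.ofFn_succ]
      congr 1
      · simp [f]
      · rw [← List.ofFn_const]
        congr 1
    rw [h1, leftBracket, fold_der _ _ _ _ hD]
    simp only [f]
    rw [zero_add, Nat.descFactorial_self, hr, natCast_zsmul]
    rw [← map_nsmul, ← map_nsmul]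
    rfl

lemma nm_adjoin (p : ℕ) (c : Fin (2 * p) → ℕ) (R : Type) [Ring R] (F : ℕ → AddSubgroup R)
    (hanti : Antitone F)
    (hF : ∀ a b, ∀ s ∈ F a, ∀ t ∈ F b, s * t - t * s ∈ F (a + b))
    (x r : Fin (2 * p) → R) (hx : ∀ i, x i ∈ F 1) (hx0 : ∑ i, x i = 0)
    (hr : ∀ i, (c i).factorial • r i = (p ^ c i) • x i)
    (hpx : ∀ i, (p ^ c i) • x i ∈ F (1 + c i))
    (m : ℕ) (a : MainLie p c) (ha : a ∈ gammaLie (MainLie p c) (m + 1))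
    (z : Equiv.Perm (Fin (2 * p)) → ℤ)
    (hz : UniversalEnvelopingAlgebra.ι ℤ a = ∑ π, ((z π : ℤ) : UniversalEnvelopingAlgebra ℤ (MainLie p c)) *
      pw (fun i => UniversalEnvelopingAlgebra.ι ℤ (gMain p c (Sum.inl i))) π) (hm : 1 ≤ m) :
    ∑ π, ((z π : ℤ) : R) * pw x π ∈ F (m + 1) := by
  refine nm_adjoin0 p c R (AddMonoid.End R[X]) (psiE R) (derE R) (derE_comm R) ?_ F hanti hF x r hx
    hx0 hr hpx m a ha z hz hm
  intro h g hhg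
  have h5 := congrArg (fun T : AddMonoid.End R[X] => T 1) hhg
  simpa only [psiE_apply, mul_one] using h5

end Adj


section Comb
open Finset

lemma digits_unique (b : ℕ) : ∀ (m : ℕ) (a a' : Fin m → ℕ), (∀ i, a i < b) → (∀ i, a' i < b) →
    ∑ i, a i * b ^ (i : ℕ) = ∑ i, a' i * b ^ (i : ℕ) → a = a' := by
  intro m
  induction m with
  | zero => intro a a' _ _ _; exact Subsingleton.elim _ _
  | succ m ih =>
    intro a a' h h' hs
    rw [Fin.sum_univ_succ, Fin.sum_univ_succ] at hs
    have e : ∀ a : Fin (m+1) → ℕ, ∑ i : Fin m, a i.succ * b ^ (i.succ : ℕ) =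
        b * ∑ i : Fin m, a i.succ * b ^ (i : ℕ) := by
      intro a
      rw [Finset.mul_sum]
      refine Finset.sum_congr rfl fun i _ => ?_
      rw [Fin.val_succ, pow_succ]; ring
    rw [e, e] at hs
    simp only [Fin.val_zero, pow_zero, mul_one] at hs
    have hb : 0 < b := lt_of_le_of_lt (Nat.zero_le _) (h 0)
    have h0 : a 0 = a' 0 := by
      have := congrArg (· % b) hs
      simpa [Nat.add_mul_mod_self_left, Nat.mod_eq_of_lt (h 0), Nat.mod_eq_of_lt (h' 0)] using this
    rw [h0] at hs
    have h1 := Nat.eq_of_mul_eq_mul_left hb (Nat.add_left_cancel hs)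
    have h2 := ih (fun i => a i.succ) (fun i => a' i.succ) (fun i => h _) (fun i => h' _) h1
    funext i
    refine Fin.cases h0 (fun i => congrFun h2 i) i

lemma list_sum_count {q : ℕ} (c : Fin q → ℕ) (T : List (Fin q)) :
    (T.map c).sum = ∑ i, T.count i * c i := by
  induction T with
  | nil => simp
  | cons a T ih =>
    simp only [List.map_cons, List.sum_cons, ih, List.count_cons, add_mul, Finset.sum_add_distrib]
    rw [add_comm]
    congr 1
    simp

lemma full_sublist {q : ℕ} (T l : List (Fin q)) (hT : T.Sublist l) (hl : l.length = q)
    (hs : (T.map fun i : Fin q => (q + 1) ^ (i : ℕ)).sum = ∑ i : Fin q, (q + 1) ^ (i : ℕ)) :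
    ∃ π : Equiv.Perm (Fin q), l = List.ofFn π := by
  rw [list_sum_count] at hs
  have h1 : (fun i => T.count i) = fun _ : Fin q => 1 := by
    refine digits_unique (q + 1) q _ _ (fun i => ?_) (fun i => ?_) ?_
    · have := List.count_le_length (a := i) (l := T)
      have := hT.length_le
      omega
    · have := i.2; omega
    · simpa using hs
  have hc : ∀ i, T.count i = 1 := fun i => congrFun h1 i
  have hnd : T.Nodup := List.nodup_iff_count_le_one.mpr fun i => (hc i).le
  have hlen : T.length = q := by
    have := list_sum_count (fun _ : Fin q => 1) T
    simpa [hc] using this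
  have : T = l := hT.eq_of_length (by omega)
  subst this
  exact nodup_perm T hnd hlen

lemma swap_rel {q : ℕ} (p : ℤ) (z : Equiv.Perm (Fin q) → ℤ)
    (h : ∀ lam : Fin q → Fin q → ℤ, (∀ k, ∑ i, lam k i = 0) → p ∣ ∑ π : Equiv.Perm (Fin q), z π * ∏ j, lam j (π j))
    (v : Equiv.Perm (Fin q)) (k l : Fin q) (hkl : k ≠ l) : p ∣ z v + z (v * Equiv.swap k l) := by
  classical
  let lam : Fin q → Fin q → ℤ := fun m =>
    if m = k ∨ m = l then Pi.single (v k) 1 - Pi.single (v l) 1 else Pi.single (v m) 1 - Pi.single (v k) 1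
  have h1 := h lam (by
    intro m
    simp only [lam]
    split_ifs <;> simp [Finset.sum_sub_distrib])
  have hvkl : v k ≠ v l := fun e => hkl (v.injective e)
  have hne : v ≠ v * Equiv.swap k l := by
    intro e
    have := congrArg (fun s : Equiv.Perm (Fin q) => s k) e
    simp at this
    exact hkl this
  have hk : lam k = Pi.single (v k) 1 - Pi.single (v l) 1 := by simp [lam]
  have hl : lam l = Pi.single (v k) 1 - Pi.single (v l) 1 := by simp [lam]
  have hm : ∀ m, m ≠ k → m ≠ l → lam m = Pi.single (v m) 1 - Pi.single (v k) 1 := by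
    intro m h1 h2; simp [lam, h1, h2]
  have hprod : ∀ π : Equiv.Perm (Fin q), ∏ j, lam j (π j) =
      lam k (π k) * lam l (π l) * ∏ j ∈ (Finset.univ.erase k).erase l, lam j (π j) := by
    intro π
    rw [mul_assoc, Finset.mul_prod_erase _ (fun j => lam j (π j)) (by simp [hkl.symm]), Finset.mul_prod_erase _ (fun j => lam j (π j)) (by simp)]
  have hz : ∀ π : Equiv.Perm (Fin q), π ≠ v → π ≠ v * Equiv.swap k l → ∏ j, lam j (π j) = 0 := by
    intro π h1 h2
    by_contra hnz
    replace hnz := Finset.prod_ne_zero_iff.mp hnz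
    have a1 : π k = v k ∨ π k = v l := by
      by_contra hc; push Not at hc
      apply hnz k (mem_univ _); simp [hk, hc.1, hc.2]
    have a2 : π l = v k ∨ π l = v l := by
      by_contra hc; push Not at hc
      apply hnz l (mem_univ _); simp [hl, hc.1, hc.2]
    have a3 : π k ≠ π l := fun e => hkl (π.injective e)
    have a4 : ∀ m, m ≠ k → m ≠ l → π m = v m := by
      intro m m1 m2
      have b1 : π m ≠ π k := fun e => m1 (π.injective e)
      have b2 : π m ≠ π l := fun e => m2 (π.injective e)
      have b3 : π m ≠ v k := by
        rcases a1 with e | e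
        · rw [← e]; exact b1
        · rcases a2 with e' | e'
          · rw [← e']; exact b2
          · exact absurd (e.trans e'.symm) a3
      by_contra hc
      apply hnz m (mem_univ _); simp [hm m m1 m2, hc, b3]
    rcases a1 with e | e
    · have e' : π l = v l := by
        rcases a2 with e' | e'
        · exact absurd (e.trans e'.symm) a3
        · exact e'
      apply h1
      ext1 m
      by_cases m1 : m = k
      · rw [m1, e]
      by_cases m2 : m = l
      · rw [m2, e']
      exact a4 m m1 m2
    · have e' : π l = v k := by
        rcases a2 with e' | e'
        · exact e'
        · exact absurd (e.trans e'.symm) a3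
      apply h2
      ext1 m
      by_cases m1 : m = k
      · rw [m1, e]; simp
      by_cases m2 : m = l
      · rw [m2, e']; simp
      rw [a4 m m1 m2, Equiv.Perm.mul_apply, Equiv.swap_apply_of_ne_of_ne m1 m2]
  have hv : ∏ j, lam j (v j) = -1 := by
    rw [hprod, Finset.prod_eq_one, hk, hl]
    · simp [hvkl, hvkl.symm]
    · intro m hmm
      simp only [mem_erase, mem_univ, and_true] at hmm
      have : v m ≠ v k := fun e => hmm.2 (v.injective e)
      simp [hm m hmm.2 hmm.1, this]
  have hv' : ∏ j, lam j ((v * Equiv.swap k l) j) = -1 := by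
    rw [hprod, Finset.prod_eq_one, hk, hl]
    · simp [hvkl, hvkl.symm]
    · intro m hmm
      simp only [mem_erase, mem_univ, and_true] at hmm
      have : v m ≠ v k := fun e => hmm.2 (v.injective e)
      rw [Equiv.Perm.mul_apply, Equiv.swap_apply_of_ne_of_ne hmm.2 hmm.1]
      simp [hm m hmm.2 hmm.1, this]
  rw [Finset.sum_eq_add_of_mem v (v * Equiv.swap k l) (mem_univ _) (mem_univ _) hne, hv, hv'] at h1
  · have h2 : z v * -1 + z (v * Equiv.swap k l) * -1 = -(z v + z (v * Equiv.swap k l)) := by ring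
    rw [h2] at h1
    exact (dvd_neg).mp h1
  · intro π _ hπ
    rw [hz π hπ.1 hπ.2, mul_zero]

lemma sign_rel {q : ℕ} (p : ℤ) (z : Equiv.Perm (Fin q) → ℤ)
    (h : ∀ (v : Equiv.Perm (Fin q)) (k l : Fin q), k ≠ l → p ∣ z v + z (v * Equiv.swap k l))
    (π : Equiv.Perm (Fin q)) : p ∣ z π - (Equiv.Perm.sign π : ℤ) * z 1 := by
  induction π using Equiv.Perm.swap_induction_on' with
  | one => simp
  | mul_swap f x y hxy ih =>
    have h1 := h f x y hxy
    rw [Equiv.Perm.sign_mul, Equiv.Perm.sign_swap hxy]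
    have := dvd_sub h1 ih
    have h2 : z f + z (f * Equiv.swap x y) - (z f - (Equiv.Perm.sign f : ℤ) * z 1) =
      z (f * Equiv.swap x y) - ((Equiv.Perm.sign f * -1 : ℤˣ) : ℤ) * z 1 := by
      rw [Units.val_mul, Units.val_neg, Units.val_one]; ring
    rwa [← h2]

end Comb


section DF
open Finset

def wd {q : ℕ} {Q : Type*} [Ring Q] (ξ : Fin q → Q) (l : List (Fin q)) : Q := (l.map ξ).prod

lemma pw_eq_wd {q : ℕ} {Q : Type*} [Ring Q] (ξ : Fin q → Q) (π : Fin q → Fin q) :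
    pw ξ π = wd ξ (List.ofFn π) := by
  rw [wd, List.map_ofFn]; rfl

def DF {q : ℕ} {Q : Type*} [Ring Q] (p : ℕ) (c : Fin q → ℕ) (ξ : Fin q → Q) (m : ℕ) : AddSubgroup Q :=
  AddSubgroup.closure {s | ∃ l T : List (Fin q), T.Sublist l ∧ m ≤ l.length + (T.map c).sum ∧
    s = ((p ^ (T.map c).sum : ℕ) : Q) * wd ξ l}

variable {q : ℕ} {Q : Type*} [Ring Q] (p : ℕ) (c : Fin q → ℕ) (ξ : Fin q → Q)

lemma DF_anti : Antitone (DF p c ξ) := by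
  intro a b hab
  refine AddSubgroup.closure_mono ?_
  rintro s ⟨l, T, h1, h2, h3⟩
  exact ⟨l, T, h1, hab.trans h2, h3⟩

lemma DF_mul (a b : ℕ) : ∀ s ∈ DF p c ξ a, ∀ t ∈ DF p c ξ b, s * t ∈ DF p c ξ (a + b) := by
  intro s hs t ht
  induction hs using AddSubgroup.closure_induction with
  | mem s hs =>
    induction ht using AddSubgroup.closure_induction with
    | mem t ht =>
      obtain ⟨l, T, h1, h2, rfl⟩ := hs
      obtain ⟨l', T', h1', h2', rfl⟩ := ht
      refine AddSubgroup.subset_closure ⟨l ++ l', T ++ T', h1.append h1', ?_, ?_⟩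
      · simp only [List.length_append, List.map_append, List.sum_append]; omega
      · simp only [List.map_append, List.sum_append, wd, List.prod_append, pow_add, Nat.cast_mul]
        rw [mul_assoc, mul_assoc]
        congr 1
        rw [← mul_assoc, ← mul_assoc, (Nat.cast_commute _ _).eq]
    | zero => rw [mul_zero]; exact zero_mem _
    | add x y _ _ hx hy => rw [mul_add]; exact add_mem hx hy
    | neg x _ hx => rw [mul_neg]; exact neg_mem hx
  | zero => rw [zero_mul]; exact zero_mem _
  | add x y _ _ hx hy => rw [add_mul]; exact add_mem hx hy
  | neg x _ hx => rw [neg_mul]; exact neg_mem hx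

lemma DF_one (i : Fin q) : ξ i ∈ DF p c ξ 1 :=
  AddSubgroup.subset_closure ⟨[i], [], by simp, by simp, by simp [wd]⟩

lemma DF_pow (i : Fin q) : ((p ^ c i : ℕ) : Q) * ξ i ∈ DF p c ξ (1 + c i) :=
  AddSubgroup.subset_closure ⟨[i], [i], by simp, by simp, by simp [wd]⟩

lemma DF_decomp (hc : ∀ i, c i = (q + 1) ^ (i : ℕ)) (s : Q) (hs : s ∈ DF p c ξ (q + ∑ i, c i)) :
    ∃ (g : Equiv.Perm (Fin q) → ℤ), ∃ u ∈ AddSubgroup.closure {s | ∃ l : List (Fin q), l.length = q ∧ s = wd ξ l},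
      ∃ r ∈ AddSubgroup.closure {s | ∃ l : List (Fin q), l.length ≠ q ∧ s = wd ξ l},
      s = ((p ^ (∑ i, c i) : ℕ) : Q) * (∑ π, ((g π : ℤ) : Q) * pw ξ π) +
        ((p ^ (∑ i, c i + 1) : ℕ) : Q) * u + r := by
  classical
  have hc' : c = fun i : Fin q => (q + 1) ^ (i : ℕ) := funext hc
  induction hs using AddSubgroup.closure_induction with
  | mem s hs =>
    obtain ⟨l, T, h1, h2, rfl⟩ := hs
    by_cases hl : l.length = q
    · have h3 : ∑ i, c i ≤ (T.map c).sum := by omega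
      rcases h3.eq_or_lt with h4 | h4
      · obtain ⟨π, hπ⟩ := full_sublist T l h1 hl (by rw [← hc', ← h4, hc'])
        refine ⟨Pi.single π 1, 0, zero_mem _, 0, zero_mem _, ?_⟩
        rw [mul_zero, add_zero, add_zero, ← h4, Finset.sum_eq_single π]
        · simp [pw_eq_wd, hπ]
        · intro b _ hb; simp [hb]
        · simp
      · refine ⟨0, ((p ^ ((T.map c).sum - (∑ i, c i + 1)) : ℕ) : Q) * wd ξ l, ?_, 0, zero_mem _, ?_⟩
        · rw [← nsmul_eq_mul]
          exact nsmul_mem (AddSubgroup.subset_closure (Set.mem_ofPred.mpr ⟨l, hl, rfl⟩)) _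
        · rw [← mul_assoc, ← Nat.cast_mul, ← pow_add, Nat.add_sub_cancel' h4]
          simp
    · refine ⟨0, 0, zero_mem _, ((p ^ (T.map c).sum : ℕ) : Q) * wd ξ l, ?_, by simp⟩
      rw [← nsmul_eq_mul]
      exact nsmul_mem (AddSubgroup.subset_closure (Set.mem_ofPred.mpr ⟨l, hl, rfl⟩)) _
  | zero => exact ⟨0, 0, zero_mem _, 0, zero_mem _, by simp⟩
  | add x y _ _ hx hy =>
    obtain ⟨g, u, hu, r, hr, e⟩ := hx
    obtain ⟨g', u', hu', r', hr', e'⟩ := hy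
    refine ⟨g + g', u + u', add_mem hu hu', r + r', add_mem hr hr', ?_⟩
    rw [e, e']
    simp only [Pi.add_apply, Int.cast_add, add_mul, Finset.sum_add_distrib, mul_add]
    abel
  | neg x _ hx =>
    obtain ⟨g, u, hu, r, hr, e⟩ := hx
    refine ⟨-g, -u, neg_mem hu, -r, neg_mem hr, ?_⟩
    rw [e]
    simp only [Pi.neg_apply, Int.cast_neg, neg_mul, Finset.sum_neg_distrib, mul_neg]
    abel

lemma DF_functional (hp : p ≠ 0) (θ : Q →+ ℚ) (t : List (Fin q) → ℤ)
    (h1 : ∀ l : List (Fin q), θ (wd ξ l) = if l.length = q then (t l : ℚ) else 0)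
    (g : Equiv.Perm (Fin q) → ℤ) (N : ℕ) (u r : Q)
    (hu : u ∈ AddSubgroup.closure {s | ∃ l : List (Fin q), l.length = q ∧ s = wd ξ l})
    (hr : r ∈ AddSubgroup.closure {s | ∃ l : List (Fin q), l.length ≠ q ∧ s = wd ξ l})
    (z : Equiv.Perm (Fin q) → ℤ)
    (he : θ (((p ^ N : ℕ) : Q) * (∑ π, ((g π : ℤ) : Q) * pw ξ π) + ((p ^ (N + 1) : ℕ) : Q) * u + r) =
      (p ^ N : ℕ) * ∑ π, (z π : ℚ) * (t (List.ofFn π) : ℚ)) :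
    (p : ℤ) ∣ ∑ π, (z π - g π) * t (List.ofFn π) := by
  have hr0 : θ r = 0 := by
    clear he
    induction hr using AddSubgroup.closure_induction with
    | mem s hs => obtain ⟨l, hl, rfl⟩ := hs; rw [h1, if_neg hl]
    | zero => simp
    | add x y _ _ hx hy => rw [map_add, hx, hy, add_zero]
    | neg x _ hx => rw [map_neg, hx, neg_zero]
  obtain ⟨k, hk⟩ : ∃ k : ℤ, θ u = k := by
    clear he
    induction hu using AddSubgroup.closure_induction with
    | mem s hs => obtain ⟨l, hl, rfl⟩ := hs; exact ⟨t l, by rw [h1, if_pos hl]⟩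
    | zero => exact ⟨0, by simp⟩
    | add x y _ _ hx hy =>
      obtain ⟨a, ha⟩ := hx; obtain ⟨b, hb⟩ := hy
      exact ⟨a + b, by rw [map_add, ha, hb]; push_cast; rfl⟩
    | neg x _ hx => obtain ⟨a, ha⟩ := hx; exact ⟨-a, by rw [map_neg, ha]; push_cast; rfl⟩
  have hmul : ∀ (n : ℕ) (s : Q), θ ((n : Q) * s) = n * θ s := by
    intro n s; rw [← nsmul_eq_mul, map_nsmul, nsmul_eq_mul]
  have hmulz : ∀ (n : ℤ) (s : Q), θ ((n : Q) * s) = n * θ s := by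
    intro n s; rw [← zsmul_eq_mul, map_zsmul, zsmul_eq_mul]
  have hpw : ∀ π : Equiv.Perm (Fin q), θ (pw ξ π) = t (List.ofFn π) := by
    intro π; rw [pw_eq_wd, h1, if_pos (by simp)]
  rw [map_add, map_add, hr0, hmul, hmul, hk, add_zero, map_sum] at he
  simp only [hmulz, hpw] at he
  refine ⟨k, ?_⟩
  have hpN : ((p ^ N : ℕ) : ℚ) ≠ 0 := by exact_mod_cast pow_ne_zero _ hp
  have h5 : ((∑ π, (z π - g π) * t (List.ofFn π) : ℤ) : ℚ) = ((p * k : ℤ) : ℚ) := by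
    push_cast
    simp only [sub_mul, Finset.sum_sub_distrib]
    apply mul_left_cancel₀ hpN
    rw [mul_sub, ← he]
    push_cast
    ring
  exact_mod_cast h5

end DF


section NM
open Finset

abbrev LamT (q : ℕ) : Type := {lam : ℕ → Fin q → ℤ // ∀ k, ∑ i, lam k i = 0}

abbrev RR (q : ℕ) : Type := LamT q → Module.End ℚ (ℕ → ℚ)

def xOp {q : ℕ} (lam : ℕ → Fin q → ℤ) (i : Fin q) : Module.End ℚ (ℕ → ℚ) where
  toFun f := fun k => (lam k i : ℚ) * f (k + 1)
  map_add' f g := by funext k; simp [mul_add]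
  map_smul' r f := by funext k; simp; ring

def xR {q : ℕ} (i : Fin q) : RR q := fun lam => xOp lam.1 i

def tl {q : ℕ} (lam : ℕ → Fin q → ℤ) : ℕ → List (Fin q) → ℤ
  | _, [] => 1
  | k, i :: l => lam k i * tl lam (k + 1) l

lemma tl_ofFn {q : ℕ} (lam : ℕ → Fin q → ℤ) : ∀ (n : ℕ) (k : ℕ) (f : Fin n → Fin q),
    tl lam k (List.ofFn f) = ∏ j : Fin n, lam (k + j) (f j) := by
  intro n
  induction n with
  | zero => intro k f; simp [tl]
  | succ n ih =>
    intro k f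
    rw [List.ofFn_succ, tl, ih, Fin.prod_univ_succ]
    congr 1
    refine Finset.prod_congr rfl fun j _ => ?_
    rw [Fin.val_succ, show k + 1 + (j : ℕ) = k + (j + 1) by omega]

lemma xOp_word {q : ℕ} (lam : ℕ → Fin q → ℤ) (l : List (Fin q)) : ∀ (k : ℕ) (f : ℕ → ℚ),
    (wd (xOp lam) l) f k = (tl lam k l : ℚ) * f (k + l.length) := by
  induction l with
  | nil => intro k f; simp [wd, tl]
  | cons a l ih =>
    intro k f
    have : wd (xOp lam) (a :: l) = xOp lam a * wd (xOp lam) l := by simp [wd]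
    rw [this, Module.End.mul_apply]
    change (lam k a : ℚ) * (wd (xOp lam) l) f (k + 1) = _
    rw [ih, tl, List.length_cons, show k + 1 + l.length = k + (l.length + 1) by omega]
    push_cast; ring

lemma map_wd {q : ℕ} {Q Q' : Type*} [Ring Q] [Ring Q'] (φ : Q →+* Q') (ξ : Fin q → Q) (l : List (Fin q)) :
    φ (wd ξ l) = wd (fun i => φ (ξ i)) l := by
  rw [wd, wd, map_list_prod, List.map_map]; rfl

def phiR {q : ℕ} (lam : LamT q) : RR q →+ ℚ where
  toFun r := (r lam) (Pi.single q 1) 0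
  map_zero' := rfl
  map_add' _ _ := rfl

lemma phiR_word {q : ℕ} (lam : LamT q) (l : List (Fin q)) :
    phiR lam (wd xR l) = if l.length = q then (tl lam.1 0 l : ℚ) else 0 := by
  change (Pi.evalRingHom (fun _ : LamT q => Module.End ℚ (ℕ → ℚ)) lam (wd xR l)) (Pi.single q 1) 0 = _
  rw [map_wd]
  change (wd (xOp lam.1) l) (Pi.single q 1) 0 = _
  rw [xOp_word, zero_add, Pi.single_apply]
  split_ifs <;> simp

noncomputable def WW (p : ℕ) (i : Fin (2 * p)) : Module.End ℤ (MvPolynomial (Fin p) ℤ) :=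
  if Even i.val then (MvPolynomial.pderiv (⟨i.val / 2, by omega⟩ : Fin p)).toLinearMap
  else LinearMap.mulLeft ℤ (MvPolynomial.X (⟨i.val / 2, by omega⟩ : Fin p))

lemma pderiv_swap {σ : Type*} [DecidableEq σ] (i j : σ) (f : MvPolynomial σ ℤ) :
    MvPolynomial.pderiv i (MvPolynomial.pderiv j f) = MvPolynomial.pderiv j (MvPolynomial.pderiv i f) := by
  have h : ⁅(MvPolynomial.pderiv i : Derivation ℤ (MvPolynomial σ ℤ) (MvPolynomial σ ℤ)),
      (MvPolynomial.pderiv j : Derivation ℤ (MvPolynomial σ ℤ) (MvPolynomial σ ℤ))⁆ = 0 := by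
    refine MvPolynomial.derivation_ext fun k => ?_
    rw [Derivation.commutator_apply, MvPolynomial.pderiv_X, MvPolynomial.pderiv_X]
    simp only [Pi.single_apply]
    split_ifs <;> simp
  have h2 := congrArg (fun D => D f) h
  simp only [Derivation.commutator_apply] at h2
  exact sub_eq_zero.mp h2

lemma WW_weyl (p : ℕ) : IsWeyl (WW p) := by
  intro i j hij
  have hij' : i.val < j.val := hij
  rw [sub_eq_iff_eq_add]
  refine LinearMap.ext fun f => ?_
  rw [LinearMap.add_apply, Module.End.mul_apply, Module.End.mul_apply]
  unfold WW
  by_cases hi : Even i.val <;> by_cases hj : Even j.val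
  · have : ¬ (j.val = i.val + 1) := by
      rintro e; rw [e] at hj; exact absurd hj (by simpa [Nat.even_add_one] using hi)
    simp only [hi, hj, this, if_true, and_false, if_false, LinearMap.zero_apply, zero_add]
    exact pderiv_swap _ _ _
  · simp only [hi, hj, if_true, true_and, if_false, LinearMap.mulLeft_apply]
    change MvPolynomial.pderiv _ (_ * f) = _ + _ * MvPolynomial.pderiv _ f
    rw [Derivation.leibniz, MvPolynomial.pderiv_X]
    by_cases e : j.val = i.val + 1
    · have e2 : j.val / 2 = i.val / 2 := by
        obtain ⟨m, hm⟩ := hi; omega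
      have e3 : (⟨j.val / 2, by omega⟩ : Fin p) = ⟨i.val / 2, by omega⟩ := Fin.ext e2
      rw [e3, Pi.single_eq_same, if_pos e, Module.End.one_apply]
      simp [add_comm]
    · have e2 : i.val / 2 ≠ j.val / 2 := by
        obtain ⟨m, hm⟩ := hi
        rw [Nat.not_even_iff_odd] at hj
        obtain ⟨m', hm'⟩ := hj; omega
      have e3 : (⟨i.val / 2, by omega⟩ : Fin p) ≠ ⟨j.val / 2, by omega⟩ := by
        intro h; exact e2 (congrArg Fin.val h)
      simp [e, e2.symm]
  · have e2 : j.val / 2 ≠ i.val / 2 := by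
      rw [Nat.not_even_iff_odd] at hi
      obtain ⟨m, hm⟩ := hj
      obtain ⟨m', hm'⟩ := hi; omega
    simp only [hi, hj, if_true, false_and, if_false, LinearMap.mulLeft_apply]
    change _ = _ + MvPolynomial.pderiv _ (_ * f)
    rw [Derivation.leibniz, MvPolynomial.pderiv_X]
    simp [e2.symm]
  · simp only [hi, hj, if_false, false_and, LinearMap.mulLeft_apply, LinearMap.zero_apply, zero_add]
    ring

end NM


section NM2
open Finset Polynomial

lemma weyl_clos {S : Type*} [Ring S] {n : ℕ} (W : Fin n → S) (hW : IsWeyl W) :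
    ∀ w ∈ AddSubgroup.closure (Set.range W), ∀ w' ∈ AddSubgroup.closure (Set.range W),
      ∃ e : ℤ, w * w' - w' * w = (e : S) := by
  intro w hw w' hw'
  induction hw using AddSubgroup.closure_induction with
  | mem s hs =>
    induction hw' using AddSubgroup.closure_induction with
    | mem t ht =>
      obtain ⟨i, rfl⟩ := hs
      obtain ⟨j, rfl⟩ := ht
      rcases lt_trichotomy i j with h | h | h
      · have := hW i j h
        split_ifs at this
        · exact ⟨1, by rw [this]; simp⟩
        · exact ⟨0, by rw [this]; simp⟩
      · subst h; exact ⟨0, by simp⟩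
      · have := hW j i h
        split_ifs at this
        · exact ⟨-1, by rw [← neg_sub, this]; simp⟩
        · exact ⟨0, by rw [← neg_sub, this]; simp⟩
    | zero => exact ⟨0, by simp⟩
    | add x y _ _ hx hy =>
      obtain ⟨a, ha⟩ := hx; obtain ⟨b, hb⟩ := hy
      exact ⟨a + b, by push_cast; rw [← ha, ← hb]; noncomm_ring⟩
    | neg x _ hx =>
      obtain ⟨a, ha⟩ := hx
      exact ⟨-a, by push_cast; rw [← ha]; noncomm_ring⟩
  | zero => exact ⟨0, by simp⟩
  | add x y _ _ hx hy =>
      obtain ⟨a, ha⟩ := hx; obtain ⟨b, hb⟩ := hy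
      exact ⟨a + b, by push_cast; rw [← ha, ← hb]; noncomm_ring⟩
  | neg x _ hx =>
      obtain ⟨a, ha⟩ := hx
      exact ⟨-a, by push_cast; rw [← ha]; noncomm_ring⟩

noncomputable def HP {S : Type*} [Ring S] {n : ℕ} (W : Fin n → S) : AddSubgroup S[X] where
  carrier := {t | ∃ w ∈ AddSubgroup.closure (Set.range W), ∃ d : ℤ, t = C w * X + C (d : S) * X ^ 2}
  zero_mem' := ⟨0, zero_mem _, 0, by simp⟩
  add_mem' := by
    rintro _ _ ⟨w, hw, d, rfl⟩ ⟨w', hw', d', rfl⟩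
    refine ⟨w + w', add_mem hw hw', d + d', ?_⟩
    rw [Int.cast_add, C_add, C_add]; noncomm_ring
  neg_mem' := by
    rintro _ ⟨w, hw, d, rfl⟩
    refine ⟨-w, neg_mem hw, -d, ?_⟩
    rw [Int.cast_neg, C_neg, C_neg]; noncomm_ring

lemma HP_comm {S : Type*} [Ring S] {n : ℕ} (W : Fin n → S) (hW : IsWeyl W) :
    ∀ s ∈ HP W, ∀ t ∈ HP W, s * t - t * s ∈ HP W := by
  rintro _ ⟨w, hw, d, rfl⟩ _ ⟨w', hw', d', rfl⟩
  obtain ⟨e, he⟩ := weyl_clos W hW w hw w' hw'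
  refine ⟨0, zero_mem _, e, ?_⟩
  have key : ∀ (a b : S) (i j : ℕ), C a * X ^ i * (C b * X ^ j) - C b * X ^ j * (C a * X ^ i) =
      C (a * b - b * a) * X ^ (i + j) := by
    intro a b i j
    rw [C_mul_X_pow_eq_monomial, C_mul_X_pow_eq_monomial, monomial_mul_monomial,
      monomial_mul_monomial, C_mul_X_pow_eq_monomial, add_comm j i, ← map_sub]
  have h1 := key w w' 1 1
  have h2 := key w (d' : S) 1 2
  have h3 := key (d : S) w' 2 1
  have h4 := key (d : S) (d' : S) 2 2
  rw [(Int.cast_commute d' w).eq, sub_self, C_0, zero_mul] at h2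
  rw [(Int.cast_commute d w').eq, sub_self, C_0, zero_mul] at h3
  rw [(Int.cast_commute d (d' : S)).eq, sub_self, C_0, zero_mul] at h4
  rw [he] at h1
  simp only [pow_one] at h1 h2 h3
  rw [C_0, zero_mul, zero_add, show X ^ 2 = (X : S[X]) ^ (1 + 1) from rfl, ← h1, show (1 + 1) = 2 from rfl]
  have : (C w * X + C (d : S) * X ^ 2) * (C w' * X + C (d' : S) * X ^ 2) -
      (C w' * X + C (d' : S) * X ^ 2) * (C w * X + C (d : S) * X ^ 2) =
      (C w * X * (C w' * X) - C w' * X * (C w * X)) +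
      (C w * X * (C (d' : S) * X ^ 2) - C (d' : S) * X ^ 2 * (C w * X)) +
      (C (d : S) * X ^ 2 * (C w' * X) - C w' * X * (C (d : S) * X ^ 2)) +
      (C (d : S) * X ^ 2 * (C (d' : S) * X ^ 2) - C (d' : S) * X ^ 2 * (C (d : S) * X ^ 2)) := by
    simp only [mul_add, add_mul]; abel
  rw [this, h2, h3, h4]; abel

lemma HP_coeff {S : Type*} [Ring S] {n : ℕ} (W : Fin n → S) (t : S[X]) (ht : t ∈ HP W) (m : ℕ)
    (hm : 3 ≤ m) : t.coeff m = 0 := by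
  obtain ⟨w, hw, d, rfl⟩ := ht
  rw [coeff_add, coeff_C_mul, coeff_C_mul, coeff_X, coeff_X_pow, if_neg (by omega), if_neg (by omega)]
  simp

lemma wd_CX {S : Type*} [Ring S] {n : ℕ} (W : Fin n → S) (l : List (Fin n)) :
    wd (fun i => C (W i) * X) l = C (wd W l) * X ^ l.length := by
  induction l with
  | nil => simp [wd]
  | cons a l ih =>
    have h1 : wd (fun i => C (W i) * X) (a :: l) = (C (W a) * X) * wd (fun i => C (W i) * X) l := by
      simp [wd]
    have h2 : wd W (a :: l) = W a * wd W l := by simp [wd]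
    rw [h1, ih, h2, C_mul, List.length_cons, pow_succ', mul_assoc, mul_assoc, ← mul_assoc X,
      (commute_X (C (wd W l))).eq, mul_assoc]

noncomputable def epsS {S : Type*} [Ring S] (ep : S →+ ℤ) (m : ℕ) : S[X] →+ ℚ where
  toFun t := (ep (t.coeff m) : ℚ)
  map_zero' := by simp
  map_add' := by intro a b; simp

lemma epsS_word {S : Type*} [Ring S] {n : ℕ} (ep : S →+ ℤ) (W : Fin n → S) (l : List (Fin n)) :
    epsS ep n (wd (fun i => C (W i) * X) l) = if l.length = n then ((ep (wd W l) : ℤ) : ℚ) else 0 := by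
  rw [wd_CX]
  change ((ep ((C (wd W l) * X ^ l.length).coeff n) : ℤ) : ℚ) = _
  rw [coeff_C_mul, coeff_X_pow]
  by_cases h : l.length = n
  · simp [h]
  · simp [h, Ne.symm h]

end NM2


section NM3
open Finset Polynomial

attribute [local instance 100] LieRing.ofAssociativeRing

lemma pw_congr_map {n : ℕ} {S S' : Type*} [Ring S] [Ring S'] (φ : S →+* S') (x : Fin n → S) (y : Fin n → S')
    (h : ∀ i, φ (x i) = y i) (π : Fin n → Fin n) : φ (pw x π) = pw y π := by
  rw [map_pw]; congr 1; funext i; exact h i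

/-- Arithmetic core of the lower bound. -/
lemma nm_core (p : ℕ) (hp : p.Prime) (c : Fin (2 * p) → ℕ)
    (hc : ∀ i, c i = (2 * p + 1) ^ (i : ℕ)) (S : Type) [Ring S] (W : Fin (2 * p) → S)
    (ep : S →+ ℤ) (hep : ep 1 = 1) (hW : IsWeyl W) (z : Equiv.Perm (Fin (2 * p)) → ℤ) (κ : ℤ)
    (hκ : ∑ π, z π • pw W π = (κ : S))
    (s : RR (2 * p) × S[X])
    (hs : s ∈ DF p c (fun i => ((xR i, C (W i) * X) : RR (2 * p) × S[X])) (2 * p + ∑ i, c i))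
    (hs2 : s.2 ∈ HP W)
    (hs1 : s.1 = ∑ π : Equiv.Perm (Fin (2 * p)), (((p : ℤ) ^ (∑ i, c i) * z π : ℤ) : RR (2 * p)) * pw xR π) :
    (p : ℤ) ∣ κ := by
  set ξ : Fin (2 * p) → RR (2 * p) × S[X] := fun i => (xR i, C (W i) * X) with hξ
  set N := ∑ i, c i with hN
  have hp0 : p ≠ 0 := hp.ne_zero
  obtain ⟨g, u, hu, r, hr, e⟩ := DF_decomp p c ξ hc s hs
  have hfst : ∀ l, (wd ξ l).1 = wd xR l := fun l => map_wd (RingHom.fst (RR (2 * p)) S[X]) ξ l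
  have hsnd : ∀ l, (wd ξ l).2 = wd (fun i => C (W i) * X) l :=
    fun l => map_wd (RingHom.snd (RR (2 * p)) S[X]) ξ l
  have A1 := DF_functional p ξ hp0 ((epsS ep (2 * p)).comp (AddMonoidHom.snd (RR (2 * p)) S[X]))
    (fun l => ep (wd W l)) (fun l => by
      change epsS ep (2 * p) (wd ξ l).2 = _
      rw [hsnd, epsS_word]) g N u r hu hr 0 (by
      rw [← e]
      change ((ep (s.2.coeff (2 * p)) : ℤ) : ℚ) = _
      rw [HP_coeff W _ hs2 _ (by have := hp.two_le; omega)]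
      simp)
  have A2 : ∀ lam : LamT (2 * p), (p : ℤ) ∣ ∑ π : Equiv.Perm (Fin (2 * p)), (z π - g π) * tl lam.1 0 (List.ofFn π) := by
    intro lam
    refine DF_functional p ξ hp0 ((phiR lam).comp (AddMonoidHom.fst (RR (2 * p)) S[X]))
      (fun l => tl lam.1 0 l) (fun l => by
      change phiR lam (wd ξ l).1 = _
      rw [hfst, phiR_word]) g N u r hu hr z ?_
    rw [← e]
    change phiR lam s.1 = _
    rw [hs1, map_sum, Finset.mul_sum]
    refine Finset.sum_congr rfl fun π _ => ?_
    rw [← zsmul_eq_mul, map_zsmul, pw_eq_wd, phiR_word, if_pos (by simp), zsmul_eq_mul]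
    push_cast
    ring
  have A3 : ∀ π, (p : ℤ) ∣ (z π - g π) - (Equiv.Perm.sign π : ℤ) * (z 1 - g 1) := by
    refine sign_rel (p : ℤ) (fun π => z π - g π) ?_
    refine swap_rel (p : ℤ) (fun π => z π - g π) ?_
    intro lam hlam
    have := A2 ⟨fun k => if h : k < 2 * p then lam ⟨k, h⟩ else 0, by
      intro k
      dsimp only
      split_ifs with h
      · exact hlam _
      · simp⟩
    simp only [tl_ofFn] at this
    simpa using this
  -- conclusion
  have B1 : ∑ π : Equiv.Perm (Fin (2 * p)), z π * ep (pw W π) = κ := by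
    have := congrArg ep hκ
    rw [map_sum] at this
    simp only [map_zsmul, smul_eq_mul] at this
    rw [this, ← zsmul_one, map_zsmul, hep]; simp
  have B2 : ∑ π : Equiv.Perm (Fin (2 * p)), (Equiv.Perm.sign π : ℤ) * ep (pw W π) = (p.factorial : ℤ) := by
    have := congrArg ep (alt_weyl p W hW)
    rw [map_sum] at this
    simp only [map_zsmul, smul_eq_mul] at this
    rw [this, ← nsmul_one, map_nsmul, hep]; simp
  have B3 : κ = ∑ π : Equiv.Perm (Fin (2 * p)), ((z π - g π) - (Equiv.Perm.sign π : ℤ) * (z 1 - g 1)) * ep (pw W π)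
      + (z 1 - g 1) * (p.factorial : ℤ)
      - ∑ π : Equiv.Perm (Fin (2 * p)), ((0 : Equiv.Perm (Fin (2 * p)) → ℤ) π - g π) * ep (wd W (List.ofFn π)) := by
    rw [← B1, ← B2, Finset.mul_sum, ← Finset.sum_add_distrib, ← Finset.sum_sub_distrib]
    refine Finset.sum_congr rfl fun π _ => ?_
    rw [← pw_eq_wd, Pi.zero_apply]; ring
  rw [B3]
  refine dvd_sub (dvd_add (Finset.dvd_sum fun π _ => (A3 π).mul_right _) ?_) A1
  refine Dvd.dvd.mul_left ?_ _
  exact_mod_cast (Nat.dvd_factorial hp.pos le_rfl)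

lemma nm_main (p : ℕ) (hp : p.Prime) (c : Fin (2 * p) → ℕ)
    (hc : ∀ i, c i = (2 * p + 1) ^ (i : ℕ)) (z : Equiv.Perm (Fin (2 * p)) → ℤ) (κ : ℤ)
    (hκ : ∀ (S : Type) (_ : Ring S) (W : Fin (2 * p) → S), IsWeyl W → ∑ π, z π • pw W π = (κ : S))
    (a : MainLie p c) (ha : a ∈ gammaLie (MainLie p c) (2 * p + ∑ i, c i))
    (hz : UniversalEnvelopingAlgebra.ι ℤ a = ∑ π : Equiv.Perm (Fin (2 * p)),
      (((p : ℤ) ^ (∑ i, c i) * z π : ℤ) : UniversalEnvelopingAlgebra ℤ (MainLie p c)) *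
      pw (fun i => UniversalEnvelopingAlgebra.ι ℤ (gMain p c (Sum.inl i))) π) :
    (p : ℤ) ∣ κ := by
  have hp2 := hp.two_le
  let S := Module.End ℤ (MvPolynomial (Fin p) ℤ)
  let W : Fin (2 * p) → S := WW p
  have hW : IsWeyl W := WW_weyl p
  let ep : S →+ ℤ :=
    { toFun := fun T => MvPolynomial.constantCoeff (T 1)
      map_zero' := map_zero MvPolynomial.constantCoeff
      map_add' := fun a b => map_add MvPolynomial.constantCoeff (a 1) (b 1) }
  have hep : ep 1 = 1 := by
    change MvPolynomial.constantCoeff ((1 : S) 1) = 1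
    simp [S]
  let ξ : Fin (2 * p) → RR (2 * p) × S[X] := fun i => (xR i, C (W i) * X)
  let HH : AddSubgroup (RR (2 * p) × S[X]) := (HP W).comap (AddMonoidHom.snd (RR (2 * p)) S[X])
  let F : ℕ → AddSubgroup (RR (2 * p)) := fun m =>
    (DF p c ξ m ⊓ HH).map (AddMonoidHom.fst (RR (2 * p)) S[X])
  have hξH : ∀ i, ξ i ∈ HH := by
    intro i
    exact ⟨W i, AddSubgroup.subset_closure ⟨i, rfl⟩, 0, by simp [ξ]⟩
  obtain ⟨M, hM⟩ : ∃ M, 2 * p + ∑ i, c i = M + 1 := ⟨2 * p + ∑ i, c i - 1, by omega⟩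
  rw [hM] at ha
  have key := nm_adjoin p c (RR (2 * p)) F ?_ ?_ xR
    (fun i lam => ((p ^ c i : ℕ) / ((c i).factorial : ℚ) : ℚ) • xR i lam) ?_ ?_ ?_ ?_ M a ha _ hz (by omega)
  · obtain ⟨s, ⟨hs1, hs2⟩, hs3⟩ := key
    rw [← hM] at hs1
    exact nm_core p hp c hc S W ep hep hW z κ (hκ S _ W hW) s hs1 hs2 hs3
  · intro a b hab
    refine AddSubgroup.map_mono ?_
    exact inf_le_inf_right _ (DF_anti p c ξ hab)
  · rintro a b _ ⟨s, ⟨hs1, hs2⟩, rfl⟩ _ ⟨t, ⟨ht1, ht2⟩, rfl⟩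
    refine ⟨s * t - t * s, ⟨?_, ?_⟩, rfl⟩
    · have h2 := DF_mul p c ξ b a t ht1 s hs1
      rw [add_comm] at h2
      exact (DF p c ξ (a + b)).sub_mem (DF_mul p c ξ a b s hs1 t ht1) h2
    · exact HP_comm W hW _ hs2 _ ht2
  · intro i
    exact ⟨ξ i, ⟨DF_one p c ξ i, hξH i⟩, rfl⟩
  · funext lam
    refine LinearMap.ext fun f => ?_
    funext k
    have : ∀ i : Fin (2 * p), (xR i lam) f k = (lam.1 k i : ℚ) * f (k + 1) := fun i => rfl
    rw [Finset.sum_apply, LinearMap.sum_apply, Finset.sum_apply]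
    simp only [this]
    rw [← Finset.sum_mul]
    have h0 := lam.2 k
    have h1 : ∑ i, (lam.1 k i : ℚ) = 0 := by exact_mod_cast h0
    rw [h1, zero_mul]; rfl
  · intro i
    funext lam
    rw [Pi.smul_apply, Pi.smul_apply, ← Nat.cast_smul_eq_nsmul ℚ, ← Nat.cast_smul_eq_nsmul ℚ, smul_smul]
    congr 1
    have : ((c i).factorial : ℚ) ≠ 0 := by exact_mod_cast Nat.factorial_ne_zero _
    field_simp
  · intro i
    refine ⟨((p ^ c i : ℕ) : RR (2 * p) × S[X]) * ξ i, ⟨DF_pow p c ξ i, ?_⟩, ?_⟩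
    · rw [← nsmul_eq_mul]
      exact nsmul_mem (hξH i) _
    · rw [← nsmul_eq_mul, map_nsmul]; rfl

end NM3


section Dyn
open Finset

attribute [local instance 100] LieRing.ofAssociativeRing

def opD (A : Type) [LieRing A] (k : ℕ) (a : A) : AddMonoid.End (A × ℤ) :=
  AddMonoidHom.mk' (fun v => (⁅a, v.1⁆ + (v.2 * k) • a, 0)) (by
    intro v w
    refine Prod.ext ?_ ?_
    · simp only [Prod.fst_add, Prod.snd_add, lie_add, add_mul, add_smul]; abel
    · simp)

lemma opD_apply (A : Type) [LieRing A] (k : ℕ) (a : A) (v : A × ℤ) :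
    opD A k a v = (⁅a, v.1⁆ + (v.2 * k) • a, 0) := rfl

lemma opD_zero (A : Type) [LieRing A] (k : ℕ) : opD A k 0 = 0 := by
  refine AddMonoidHom.ext fun v => ?_
  change ((⁅(0 : A), v.1⁆ + (v.2 * k) • (0 : A), 0) : A × ℤ) = 0
  rw [zero_lie, smul_zero, add_zero]; rfl

lemma opD_add (A : Type) [LieRing A] (k : ℕ) (a b : A) : opD A k a + opD A k b = opD A k (a + b) := by
  refine AddMonoidHom.ext fun v => ?_
  change ((⁅a, v.1⁆ + (v.2 * k) • a, 0) : A × ℤ) + (⁅b, v.1⁆ + (v.2 * k) • b, 0) =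
    (⁅a + b, v.1⁆ + (v.2 * k) • (a + b), 0)
  rw [add_lie, smul_add]
  refine Prod.ext ?_ ?_
  · simp only [Prod.fst_add]; abel
  · simp

lemma opD_neg (A : Type) [LieRing A] (k : ℕ) (a : A) : -opD A k a = opD A k (-a) := by
  refine neg_eq_of_add_eq_zero_right ?_
  rw [opD_add, add_neg_cancel, opD_zero]

lemma opD_comm (A : Type) [LieRing A] (k l : ℕ) (a b : A) :
    opD A k a * opD A l b - opD A l b * opD A k a = opD A (k + l) ⁅a, b⁆ := by
  refine AddMonoidHom.ext fun v => ?_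
  change ((⁅a, ⁅b, v.1⁆ + (v.2 * l) • b⁆ + ((0 : ℤ) * k) • a, 0) : A × ℤ) -
    (⁅b, ⁅a, v.1⁆ + (v.2 * k) • a⁆ + ((0 : ℤ) * l) • b, 0) =
    (⁅⁅a, b⁆, v.1⁆ + (v.2 * ((k + l : ℕ) : ℤ)) • ⁅a, b⁆, 0)
  refine Prod.ext ?_ ?_
  · simp only [Prod.fst_sub, zero_mul, zero_smul, add_zero, lie_add, lie_zsmul]
    have h1 := leibniz_lie a b v.1
    have h2 : ⁅b, a⁆ = -⁅a, b⁆ := (lie_skew b a).symm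
    rw [h1, h2, Nat.cast_add, mul_add, add_smul, smul_neg]
    abel
  · simp

noncomputable def LD (A : Type) [LieRing A] [LieAlgebra ℤ A] (k : ℕ) :
    AddSubgroup (UniversalEnvelopingAlgebra ℤ A × AddMonoid.End (A × ℤ)) where
  carrier := {s | ∃ a : A, s = (UniversalEnvelopingAlgebra.ι ℤ a, opD A k a)}
  zero_mem' := ⟨0, Prod.ext (map_zero _).symm (opD_zero A k).symm⟩
  add_mem' := by
    rintro _ _ ⟨a, rfl⟩ ⟨b, rfl⟩
    exact ⟨a + b, Prod.ext (map_add _ _ _).symm (opD_add A k a b)⟩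
  neg_mem' := by
    rintro _ ⟨a, rfl⟩
    exact ⟨-a, Prod.ext (map_neg _ _).symm (opD_neg A k a)⟩

lemma LD_comm (A : Type) [LieRing A] [LieAlgebra ℤ A] (k l : ℕ) :
    ∀ s ∈ LD A k, ∀ t ∈ LD A l, s * t - t * s ∈ LD A (k + l) := by
  rintro _ ⟨a, rfl⟩ _ ⟨b, rfl⟩
  refine ⟨⁅a, b⁆, Prod.ext ?_ ?_⟩
  · exact (LieHom.map_lie (UniversalEnvelopingAlgebra.ι ℤ) a b).symm
  · exact opD_comm A k l a b

def rb {A : Type} [LieRing A] {q : ℕ} (x : Fin q → A) : List (Fin q) → A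
  | [] => 0
  | [i] => x i
  | i :: j :: l => ⁅x i, rb x (j :: l)⁆

lemma wd_cons {q : ℕ} {Q : Type*} [Ring Q] (ξ : Fin q → Q) (a : Fin q) (l : List (Fin q)) :
    wd ξ (a :: l) = ξ a * wd ξ l := by simp [wd]

lemma opD_word {A : Type} [LieRing A] {q : ℕ} (x : Fin q → A) (l : List (Fin q)) (hl : l ≠ []) :
    (wd (fun i => opD A 1 (x i)) l) (0, 1) = (rb x l, 0) := by
  induction l with
  | nil => exact absurd rfl hl
  | cons a l ih =>
    rw [wd_cons]
    change opD A 1 (x a) ((wd (fun i => opD A 1 (x i)) l) (0, 1)) = _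
    cases l with
    | nil => 
      change opD A 1 (x a) (0, 1) = _
      rw [opD_apply]; simp [rb]
    | cons b l =>
      rw [ih (by simp), opD_apply]; simp [rb]

def evD (A : Type) [LieRing A] : AddMonoid.End (A × ℤ) →+ A where
  toFun T := (T (0, 1)).1
  map_zero' := rfl
  map_add' _ _ := rfl

lemma dynkin (p : ℕ) (hp : p.Prime) : ∃ z : Equiv.Perm (Fin (2 * p)) → ℤ, ∃ κ : ℤ, ¬ (p : ℤ) ∣ κ ∧
    (∀ (S : Type) (_ : Ring S) (W : Fin (2 * p) → S), IsWeyl W → ∑ π, z π • pw W π = (κ : S)) ∧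
    ∀ (A : Type) [LieRing A] [LieAlgebra ℤ A] (x : Fin (2 * p) → A), ∑ i, x i = 0 →
      ∃ ζ : A, UniversalEnvelopingAlgebra.ι ℤ ζ = ∑ π : Equiv.Perm (Fin (2 * p)),
          ((z π : ℤ) : UniversalEnvelopingAlgebra ℤ A) * pw (fun i => UniversalEnvelopingAlgebra.ι ℤ (x i)) π ∧
        (2 * p) • ζ = ∑ π : Equiv.Perm (Fin (2 * p)), z π • rb x (List.ofFn π) := by
  obtain ⟨k, rfl⟩ : ∃ k, p = k + 1 := ⟨p - 1, by have := hp.pos; omega⟩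
  obtain ⟨z, κ, h1, h2, h3⟩ := core_lemma (k + 1) k hp rfl
  refine ⟨z, κ, h1, h3, ?_⟩
  intro A _ _ x hx
  obtain ⟨ζ, hζ⟩ := h2 (UniversalEnvelopingAlgebra ℤ A × AddMonoid.End (A × ℤ)) inferInstance (LD A)
    (LD_comm A) (fun i => (UniversalEnvelopingAlgebra.ι ℤ (x i), opD A 1 (x i)))
    (fun i => ⟨x i, rfl⟩) (by
      have hs : ∀ s : Finset (Fin (2 * (k + 1))), ∑ i ∈ s, ((UniversalEnvelopingAlgebra.ι ℤ (x i), opD A 1 (x i)) :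
          UniversalEnvelopingAlgebra ℤ A × AddMonoid.End (A × ℤ)) =
          (UniversalEnvelopingAlgebra.ι ℤ (∑ i ∈ s, x i), opD A 1 (∑ i ∈ s, x i)) := by
        classical
        intro s
        induction s using Finset.induction_on with
        | empty =>
          simp only [Finset.sum_empty]
          exact Prod.ext (map_zero _).symm (opD_zero A 1).symm
        | insert a s ha ih =>
          rw [Finset.sum_insert ha, Finset.sum_insert ha, ih]
          exact Prod.ext (map_add _ _ _).symm (opD_add A 1 _ _)
      refine (hs univ).trans ?_
      rw [hx]
      exact Prod.ext (map_zero _) (opD_zero A 1))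
  refine ⟨ζ, ?_, ?_⟩
  · have h := congrArg (RingHom.fst (UniversalEnvelopingAlgebra ℤ A) (AddMonoid.End (A × ℤ))) hζ
    rw [map_sum] at h
    refine Eq.trans h.symm ?_
    refine Finset.sum_congr rfl fun π _ => ?_
    rw [map_zsmul, map_pw, zsmul_eq_mul]
    rfl
  · have h := congrArg (RingHom.snd (UniversalEnvelopingAlgebra ℤ A) (AddMonoid.End (A × ℤ))) hζ
    have h' := congrArg (evD A) h
    rw [map_sum, map_sum] at h'
    have e1 : (evD A) (opD A (2 * (k + 1)) ζ) = (2 * (k + 1)) • ζ := by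
      change (opD A (2 * (k + 1)) ζ (0, 1)).1 = _
      rw [opD_apply, lie_zero, zero_add, one_mul, natCast_zsmul]
    refine Eq.trans (e1.symm.trans h'.symm) ?_
    refine Finset.sum_congr rfl fun π _ => ?_
    rw [map_zsmul, map_pw, map_zsmul]
    congr 1
    rw [pw_eq_wd]
    change ((wd (fun i => opD A 1 (x i)) (List.ofFn π)) (0, 1)).1 = _
    rw [opD_word x _ (by simp)]

end Dyn


section Memb
open Finset

attribute [local instance 100] LieRing.ofAssociativeRing

lemma lie_lcs {A : Type} [LieRing A] (i : ℕ) : ∀ (j : ℕ) (u v : A),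
    u ∈ LieModule.lowerCentralSeries ℤ A A i → v ∈ LieModule.lowerCentralSeries ℤ A A j →
    ⁅u, v⁆ ∈ LieModule.lowerCentralSeries ℤ A A (i + j + 1) := by
  have hs : ∀ (j : ℕ) (u v : A), v ∈ LieModule.lowerCentralSeries ℤ A A j →
      ⁅u, v⁆ ∈ LieModule.lowerCentralSeries ℤ A A (j + 1) := by
    intro j u v hv
    rw [LieModule.lowerCentralSeries_succ]
    exact LieSubmodule.lie_mem_lie (LieSubmodule.mem_top u) hv
  induction i with
  | zero =>
    intro j u v _ hv
    rw [zero_add]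
    exact hs j u v hv
  | succ i ih =>
    intro j u v hu hv
    rw [LieModule.lowerCentralSeries_succ] at hu
    rw [← LieSubmodule.mem_toSubmodule, LieSubmodule.lieIdeal_oper_eq_linear_span'] at hu
    induction hu using Submodule.span_induction with
    | mem x hx =>
      obtain ⟨a, -, b, hb, rfl⟩ := hx
      rw [lie_lie]
      refine sub_mem ?_ ?_
      · have := hs _ a _ (ih j b v hb hv)
        rw [show i + 1 + j + 1 = i + j + 1 + 1 by omega]; exact this
      · have := ih (j + 1) b _ hb (hs j a v hv)
        rw [show i + 1 + j + 1 = i + (j + 1) + 1 by omega]; exact this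
    | zero => rw [zero_lie]; exact zero_mem _
    | add x y _ _ hx hy => rw [add_lie]; exact add_mem hx hy
    | smul r x _ hx =>
      have : ⁅r • x, v⁆ = r • ⁅x, v⁆ := smul_lie r x v
      rw [this]; exact (LieModule.lowerCentralSeries ℤ A A _).smul_mem r hx

lemma foldl_lcs {A : Type} [LieRing A] (l : List A) : ∀ (k : ℕ) (a : A),
    a ∈ LieModule.lowerCentralSeries ℤ A A k →
    l.foldl (fun x y => ⁅x, y⁆) a ∈ LieModule.lowerCentralSeries ℤ A A (k + l.length) := by
  induction l with
  | nil => intro k a ha; exact ha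
  | cons b l ih =>
    intro k a ha
    have h := ih (k + 1) ⁅a, b⁆ (lie_lcs k 0 a b ha (by simp))
    rw [List.foldl_cons, List.length_cons, show k + (l.length + 1) = k + 1 + l.length by omega]
    exact h

lemma leftBracket_lcs {A : Type} [LieRing A] (l : List A) (k : ℕ) (hl : l.length = 1 + k) :
    leftBracket l ∈ LieModule.lowerCentralSeries ℤ A A k := by
  cases l with
  | nil => simp at hl; omega
  | cons a l =>
    have h := foldl_lcs l 0 a (by simp)
    have e : 0 + l.length = k := by simp at hl; omega
    rw [e] at h
    exact h

lemma pow_comm_mem {R U : Type} [CommRing R] [Ring U] [Algebra R U] (I : Submodule R U) (k : ℕ) (a b : U)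
    (ha : a ∈ I ^ k) (hb : b ∈ I) : a * b - b * a ∈ I ^ (k + 1) := by
  refine sub_mem ?_ ?_
  · rw [pow_succ]; exact Submodule.mul_mem_mul ha hb
  · rw [pow_succ']; exact Submodule.mul_mem_mul hb ha

lemma pow_one_mem {R U : Type} [CommRing R] [Ring U] [Algebra R U] (I : Submodule R U) (b : U)
    (hb : b ∈ I) : b ∈ I ^ 1 := by
  rw [pow_one]; exact hb

lemma foldl_aug {A : Type} [LieRing A] (l : List A) : ∀ (k : ℕ) (a : A),
    UniversalEnvelopingAlgebra.ι ℤ a ∈ augIdealLie A ^ k →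
    UniversalEnvelopingAlgebra.ι ℤ (l.foldl (fun x y => ⁅x, y⁆) a) ∈ augIdealLie A ^ (k + l.length) := by
  induction l with
  | nil => intro k a ha; exact ha
  | cons b l ih =>
    intro k a ha
    have hb : UniversalEnvelopingAlgebra.ι ℤ b ∈ augIdealLie A :=
      Submodule.subset_span ⟨1, 1, b, by rw [one_mul, mul_one]⟩
    have h := ih (k + 1) ⁅a, b⁆ (by
      have e : UniversalEnvelopingAlgebra.ι ℤ ⁅a, b⁆ = UniversalEnvelopingAlgebra.ι ℤ a * UniversalEnvelopingAlgebra.ι ℤ b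
        - UniversalEnvelopingAlgebra.ι ℤ b * UniversalEnvelopingAlgebra.ι ℤ a :=
        LieHom.map_lie (UniversalEnvelopingAlgebra.ι ℤ) a b
      rw [e]
      exact pow_comm_mem (augIdealLie A) k _ _ ha hb)
    rw [List.foldl_cons, List.length_cons, show k + (l.length + 1) = k + 1 + l.length by omega]
    exact h

lemma leftBracket_aug {A : Type} [LieRing A] (l : List A) (k : ℕ) (hl : l.length = 1 + k) :
    UniversalEnvelopingAlgebra.ι ℤ (leftBracket l) ∈ augIdealLie A ^ (1 + k) := by
  cases l with
  | nil => simp at hl; omega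
  | cons a l =>
    have h := foldl_aug l 1 a 
      (pow_one_mem (augIdealLie A) _ (Submodule.subset_span ⟨1, 1, a, by rw [one_mul, mul_one]⟩))
    have e : l.length = k := by simp at hl; omega
    rw [e] at h
    exact h

lemma rb_lcs {A : Type} [LieRing A] {q : ℕ} (x : Fin q → A) (p : ℕ) (c : Fin q → ℕ)
    (hx : ∀ i, ((p ^ (c i) : ℕ) : ℤ) • x i ∈ LieModule.lowerCentralSeries ℤ A A (c i)) (l : List (Fin q)) :
    ∀ m : ℕ, l.length + (l.map c).sum = m + 1 →
    ((p ^ ((l.map c).sum) : ℕ) : ℤ) • rb x l ∈ LieModule.lowerCentralSeries ℤ A A m := by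
  induction l with
  | nil => intro m h; simp at h
  | cons i l ih =>
    intro m h
    cases l with
    | nil =>
      have e : c i = m := by simp at h; omega
      subst e
      simpa [rb] using hx i
    | cons j l =>
      have h2 := ih (l.length + ((j :: l).map c).sum) (by simp; omega)
      have h3 := lie_lcs _ _ _ _ (hx i) h2
      rw [smul_lie, lie_smul, smul_smul, ← Nat.cast_mul, ← pow_add] at h3
      have e1 : ((i :: j :: l).map c).sum = c i + ((j :: l).map c).sum := by simp
      have e2 : m = c i + (l.length + ((j :: l).map c).sum) + 1 := by
        rw [e1] at h; simp at h ⊢; omega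
      rw [e1, e2]
      exact h3

lemma wd_aug {R U : Type} [CommRing R] [Ring U] [Algebra R U] (I : Submodule R U) {q : ℕ} (x : Fin q → U) (p : ℕ) (c : Fin q → ℕ)
    (hx : ∀ i, ((p ^ (c i) : ℕ) : U) * x i ∈ I ^ (1 + c i)) (l : List (Fin q)) :
    ((p ^ ((l.map c).sum) : ℕ) : U) * wd x l ∈ I ^ (l.length + (l.map c).sum) := by
  induction l with
  | nil => simp [wd, Submodule.one_le.mp le_rfl]
  | cons i l ih =>
    have h := Submodule.mul_mem_mul (hx i) ih
    rw [← pow_add] at h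
    have e1 : ((i :: l).map c).sum = c i + (l.map c).sum := by simp
    have e2 : (i :: l).length + ((i :: l).map c).sum = 1 + c i + (l.length + (l.map c).sum) := by
      rw [e1]; simp; omega
    rw [e2, e1, wd_cons, pow_add p, Nat.cast_mul]
    convert h using 1
    rw [mul_assoc, mul_assoc, ← mul_assoc _ (x i), (Nat.cast_commute _ (x i)).eq, mul_assoc]

lemma perm_sum {q : ℕ} (c : Fin q → ℕ) (π : Equiv.Perm (Fin q)) :
    ((List.ofFn π).map c).sum = ∑ i, c i := by
  rw [List.map_ofFn, List.sum_ofFn]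
  exact Equiv.sum_comp π c

end Memb


section Fin16
open Finset

attribute [local instance 100] LieRing.ofAssociativeRing

lemma cand_mem (p : ℕ) (c : Fin (2 * p) → ℕ) (hp : 0 < p) (z : Equiv.Perm (Fin (2 * p)) → ℤ) (ζ : MainLie p c)
    (h1 : UniversalEnvelopingAlgebra.ι ℤ ζ = ∑ π : Equiv.Perm (Fin (2 * p)),
          ((z π : ℤ) : UniversalEnvelopingAlgebra ℤ (MainLie p c)) *
            pw (fun i => UniversalEnvelopingAlgebra.ι ℤ (gMain p c (Sum.inl i))) π)
    (h2 : (2 * p) • ζ = ∑ π : Equiv.Perm (Fin (2 * p)), z π • rb (fun i => gMain p c (Sum.inl i)) (List.ofFn π)) :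
    UniversalEnvelopingAlgebra.ι ℤ (((p ^ (∑ i, c i) : ℕ) : ℤ) • ζ) =
        ∑ π : Equiv.Perm (Fin (2 * p)),
          (((p : ℤ) ^ (∑ i, c i) * z π : ℤ) : UniversalEnvelopingAlgebra ℤ (MainLie p c)) *
            pw (fun i => UniversalEnvelopingAlgebra.ι ℤ (gMain p c (Sum.inl i))) π ∧
    ((p ^ (∑ i, c i) : ℕ) : ℤ) • ζ ∈ dimensionSubring (MainLie p c) (2 * p + ∑ i, c i) ∧
    (2 * p) • (((p ^ (∑ i, c i) : ℕ) : ℤ) • ζ) ∈ gammaLie (MainLie p c) (2 * p + ∑ i, c i) := by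
  have e : UniversalEnvelopingAlgebra.ι ℤ (((p ^ (∑ i, c i) : ℕ) : ℤ) • ζ) =
        ∑ π : Equiv.Perm (Fin (2 * p)),
          (((p : ℤ) ^ (∑ i, c i) * z π : ℤ) : UniversalEnvelopingAlgebra ℤ (MainLie p c)) *
            pw (fun i => UniversalEnvelopingAlgebra.ι ℤ (gMain p c (Sum.inl i))) π := by
    refine (map_zsmul (UniversalEnvelopingAlgebra.ι ℤ) _ ζ).trans ?_
    rw [h1, zsmul_eq_mul, Finset.mul_sum]
    refine Finset.sum_congr rfl fun π _ => ?_
    rw [← mul_assoc, Int.cast_mul, Nat.cast_pow]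
  refine ⟨e, ?_, ?_⟩
  · change UniversalEnvelopingAlgebra.ι ℤ (((p ^ (∑ i, c i) : ℕ) : ℤ) • ζ) ∈ augIdealLie (MainLie p c) ^ (2 * p + ∑ i, c i)
    rw [e]
    refine sum_mem fun π _ => ?_
    have h3 := wd_aug (augIdealLie (MainLie p c))
      (fun i => UniversalEnvelopingAlgebra.ι ℤ (gMain p c (Sum.inl i))) p c (by
        intro i
        have h4 := leftBracket_aug (List.ofFn fun j : Fin (1 + c i) => gMain p c (Sum.inr ⟨i, j⟩)) (c i) (by simp)
        rw [← gMain_rel] at h4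
        have h5 := (map_zsmul (UniversalEnvelopingAlgebra.ι ℤ) ((p ^ (c i) : ℕ) : ℤ) (gMain p c (Sum.inl i)))
        have h6 := h5.trans (zsmul_eq_mul _ _)
        rw [Int.cast_natCast] at h6
        rw [← h6]
        exact h4) (List.ofFn π)
    rw [perm_sum, List.length_ofFn, ← pw_eq_wd] at h3
    have h7 := zsmul_mem h3 (z π)
    rw [zsmul_eq_mul, ← mul_assoc] at h7
    rw [mul_comm ((p : ℤ) ^ _), Int.cast_mul, Int.cast_pow, Int.cast_natCast]
    rw [Nat.cast_pow] at h7
    exact h7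
  · have e2 : (2 * p) • (((p ^ (∑ i, c i) : ℕ) : ℤ) • ζ) = ((p ^ (∑ i, c i) : ℕ) : ℤ) • ((2 * p) • ζ) :=
      smul_comm _ _ _
    rw [e2, h2, Finset.smul_sum]
    refine sum_mem fun π _ => ?_
    rw [smul_comm]
    refine zsmul_mem ?_ _
    have h3 := rb_lcs (fun i => gMain p c (Sum.inl i)) p c (by
        intro i
        have h4 := leftBracket_lcs (List.ofFn fun j : Fin (1 + c i) => gMain p c (Sum.inr ⟨i, j⟩)) (c i) (by simp)
        rw [← gMain_rel] at h4
        exact h4) (List.ofFn π) (2 * p + ∑ i, c i - 1) (by rw [perm_sum, List.length_ofFn]; omega)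
    rw [perm_sum] at h3
    exact h3

end Fin16

theorem main_theorem_lie (p : ℕ) (hp : p.Prime) :
    ∃ (n : ℕ) (c : Fin (2 * p) → ℕ), 0 < n ∧ (∀ i, 0 < c i) ∧
      ∃ a : MainLie p c,
        a ∈ dimensionSubring (MainLie p c) n ∧
        a ∉ gammaLie (MainLie p c) n ∧
        (p : ℤ) • a ∈ gammaLie (MainLie p c) n := by
  obtain ⟨z, κ, hκ, hW, hD⟩ := dynkin p hp
  let c : Fin (2 * p) → ℕ := fun i => (2 * p + 1) ^ (i : ℕ)
  have hp0 := hp.pos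
  refine ⟨2 * p + ∑ i, c i, c, by omega, fun i => by positivity, ?_⟩
  obtain ⟨ζ, h1, h2⟩ := hD (MainLie p c) (fun i => gMain p c (Sum.inl i)) (gMain_sum p c)
  obtain ⟨e, hd, hg⟩ := cand_mem p c hp0 z ζ h1 h2
  generalize ((p ^ (∑ i, c i) : ℕ) : ℤ) • ζ = a at e hd hg
  have hna : a ∉ gammaLie (MainLie p c) (2 * p + ∑ i, c i) := fun ha =>
    hκ (nm_main p hp c (fun _ => rfl) z κ hW a ha e)
  have hd2 : (2 : ℤ) • a ∈ dimensionSubring (MainLie p c) (2 * p + ∑ i, c i) := by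
    have h3 := zsmul_mem (show UniversalEnvelopingAlgebra.ι ℤ a ∈ augIdealLie (MainLie p c) ^ (2 * p + ∑ i, c i) from hd) 2
    have h4 := map_zsmul (UniversalEnvelopingAlgebra.ι ℤ) (2 : ℤ) a
    exact Eq.mpr (congrArg (· ∈ augIdealLie (MainLie p c) ^ (2 * p + ∑ i, c i)) h4) h3
  have hg2 : (p : ℤ) • ((2 : ℤ) • a) ∈ gammaLie (MainLie p c) (2 * p + ∑ i, c i) := by
    have e3 : (p : ℤ) • ((2 : ℤ) • a) = (2 * p) • a := by
      rw [smul_smul, ← natCast_zsmul]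
      congr 1
      push_cast; ring
    rw [e3]; exact hg
  by_cases h : (2 : ℤ) • a ∈ gammaLie (MainLie p c) (2 * p + ∑ i, c i)
  · by_cases hp2 : p = 2
    · refine ⟨a, hd, hna, ?_⟩
      have : (p : ℤ) = 2 := by rw [hp2]; rfl
      rw [this]; exact h
    · exfalso
      have h5 := nm_main p hp c (fun _ => rfl) (fun π => 2 * z π) (2 * κ) (by
        intro S _ W hWW
        have := hW S inferInstance W hWW
        rw [Int.cast_mul, ← this, Finset.mul_sum]
        refine Finset.sum_congr rfl fun π _ => ?_
        rw [mul_smul, zsmul_eq_mul]) _ h (by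
        have h4 := map_zsmul (UniversalEnvelopingAlgebra.ι ℤ) (2 : ℤ) a
        refine h4.trans ?_
        rw [e, zsmul_eq_mul, Finset.mul_sum]
        refine Finset.sum_congr rfl fun π _ => ?_
        rw [← mul_assoc, ← Int.cast_mul]
        congr 2
        ring)
      rcases (Nat.prime_iff_prime_int.mp hp).dvd_or_dvd h5 with h6 | h6
      · have h7 : p ∣ 2 := by exact_mod_cast h6
        exact hp2 ((Nat.prime_dvd_prime_iff_eq hp Nat.prime_two).mp h7)
      · exact hκ h6
  · exact ⟨(2 : ℤ) • a, hd2, h, hg2⟩
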